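/- arXiv:math/0609735 — 7 statements merged into one kernel-verified Lean document; each statement's English description precedes it below -/
import Mathlib

section
/- Let γ be a *-automorphism of M₂(A) that fixes the projection diag(0, 1) (the matrix with the unit of A in the (2,2) entry and zeros elsewhere). Then there exist a *-automorphism σ of A and a unitary u ∈ A such that for every matrix a = (a_{ij}) ∈ M₂(A), γ(a) = diag(u, 1) · (σ(a_{ij}))_{ij} · diag(u, 1)*, i.e., γ is the composition of the entrywise application of σ with conjugation by the unitary diag(u, 1). -/
namespace Matrix

variable {n A : Type*} [Fintype n] [DecidableEq n] [Ring A] [StarRing A] [Algebra ℂ A]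

/-- A star-algebra automorphism of a matrix algebra fixing the diagonal matrix units acts on each
entry separately. -/
theorem starAlgEquiv_apply_apply_of_fixes_diagonal_units
    {γ : Matrix n n A ≃⋆ₐ[ℂ] Matrix n n A} (hγ : ∀ i, γ (single i i 1) = single i i 1)
    (a : Matrix n n A) (i j : n) : γ a i j = γ (single i j (a i j)) i j := by
  have h : single i j (a i j) = single i i 1 * a * single j j 1 := by
    simp [single_mul_mul_single]
  rw [h, map_mul, map_mul, hγ, hγ]
  simp

theorem starAlgEquiv_apply_single_of_fixes_diagonal_units
    {γ : Matrix n n A ≃⋆ₐ[ℂ] Matrix n n A} (hγ : ∀ i, γ (single i i 1) = single i i 1)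
    (i j : n) (a : A) : γ (single i j a) = single i j (γ (single i j a) i j) := by
  have h : single i j a = single i i 1 * single i j a * single j j 1 := by simp
  conv_lhs => rw [h, map_mul, map_mul, hγ, hγ, single_mul_mul_single]
  simp

theorem starAlgEquiv_corner_mul_of_fixes_diagonal_units
    {γ : Matrix n n A ≃⋆ₐ[ℂ] Matrix n n A} (hγ : ∀ i, γ (single i i 1) = single i i 1)
    (i j k : n) (a b : A) :
    γ (single i k (a * b)) i k = γ (single i j a) i j * γ (single j k b) j k := by
  have h : single i k (a * b) = single i j a * single j k b := by simp
  rw [h, map_mul,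
    starAlgEquiv_apply_single_of_fixes_diagonal_units hγ i j,
    starAlgEquiv_apply_single_of_fixes_diagonal_units hγ j k]
  simp

theorem starAlgEquiv_corner_star (γ : Matrix n n A ≃⋆ₐ[ℂ] Matrix n n A) (i j : n) (a : A) :
    γ (single j i (star a)) j i = star (γ (single i j a) i j) := by
  rw [← conjTranspose_single, ← star_eq_conjTranspose, map_star, star_apply]

/-- The automorphism induced on a diagonal corner by a star-algebra automorphism of a matrix
algebra fixing the diagonal matrix units. -/
def cornerStarAlgEquiv (γ : Matrix n n A ≃⋆ₐ[ℂ] Matrix n n A)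
    (hγ : ∀ i, γ (single i i 1) = single i i 1) (i : n) : A ≃⋆ₐ[ℂ] A where
  toFun a := γ (single i i a) i i
  invFun a := γ.symm (single i i a) i i
  left_inv a := by
    dsimp only
    rw [← starAlgEquiv_apply_single_of_fixes_diagonal_units hγ]
    simp
  right_inv a := by
    have h : ∀ i, γ.symm (single i i 1) = single i i 1 := fun i => by
      rw [← hγ i, γ.symm_apply_apply, hγ]
    dsimp only
    rw [← starAlgEquiv_apply_single_of_fixes_diagonal_units h]
    simp
  map_mul' a b := starAlgEquiv_corner_mul_of_fixes_diagonal_units hγ i i i a b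
  map_add' a b := by simp [single_add]
  map_star' a := starAlgEquiv_corner_star γ i i a
  map_smul' c a := by rw [← smul_single, map_smul, smul_apply]

end Matrix

/-- **Lemma.** If an automorphism `γ` of `M₂(A)` fixes the projection `diag(0,1)`,
then `γ = Ad(diag(u,1)) ∘ (id ⊗ σ)` for some automorphism `σ` of `A` and some
unitary `u ∈ A`; here `id ⊗ σ` is the entrywise application of `σ`. -/
theorem automorphism_fixing_corner_projection (A : Type*) [CStarAlgebra A]
    (γ : Matrix (Fin 2) (Fin 2) A ≃⋆ₐ[ℂ] Matrix (Fin 2) (Fin 2) A)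
    (hγ : γ (Matrix.diagonal ![0, 1]) = Matrix.diagonal ![0, 1]) :
    ∃ (σ : A ≃⋆ₐ[ℂ] A) (u : A), u ∈ unitary A ∧
      ∀ a : Matrix (Fin 2) (Fin 2) A,
        γ a = Matrix.diagonal ![u, 1] * a.map (⇑σ) * star (Matrix.diagonal ![u, 1]) := by
  have h₁ : Matrix.diagonal ![0, 1] = Matrix.single (1 : Fin 2) 1 (1 : A) := by
    ext i j; fin_cases i <;> fin_cases j <;> simp
  have h₀ : Matrix.single (0 : Fin 2) (0 : Fin 2) (1 : A) = 1 - Matrix.single 1 1 1 := by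
    ext i j; fin_cases i <;> fin_cases j <;> simp
  rw [h₁] at hγ
  have hfix : ∀ i, γ (Matrix.single i i 1) = Matrix.single i i 1 := by
    intro i
    fin_cases i
    · simp [h₀, hγ]
    · exact hγ
  have hmul := Matrix.starAlgEquiv_corner_mul_of_fixes_diagonal_units hfix
  have hstar : γ (Matrix.single 1 0 1) 1 0 = star (γ (Matrix.single 0 1 1) 0 1) := by
    simpa using Matrix.starAlgEquiv_corner_star γ 0 1 1
  refine ⟨Matrix.cornerStarAlgEquiv γ hfix 1, γ (Matrix.single 0 1 1) (0 : Fin 2) (1 : Fin 2), ?_, fun a => ?_⟩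
  · rw [Unitary.mem_iff, ← hstar, ← hmul, ← hmul]
    simp [hfix]
  · have hσ (b : A) : Matrix.cornerStarAlgEquiv γ hfix 1 b = γ (Matrix.single 1 1 b) 1 1 := rfl
    ext i j
    rw [Matrix.starAlgEquiv_apply_apply_of_fixes_diagonal_units hfix,
      Matrix.star_eq_conjTranspose, Matrix.diagonal_conjTranspose, Matrix.mul_diagonal,
      Matrix.diagonal_mul, Matrix.map_apply, hσ]
    fin_cases i <;> fin_cases j <;> simp [← hstar, ← hmul]
end

section
/- For a *-automorphism θ of a unital C*-algebra A, the following are equivalent: (1) for every x, y ∈ A there exists a *-automorphism γ of M₂(A) such that γ(diag(x, y)) = diag(θ(x), y); (2) θ is locally inner, i.e., for every x ∈ A there is a unitary u ∈ A with θ(x) = u x u*. -/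
/-- A Sylvester-type equation `a v - v b = c v` has only the trivial solution when the scalar `c`
is larger than `‖a‖ + ‖b‖`. -/
theorem eq_zero_of_mul_sub_mul_eq_smul {A : Type*} [NormedRing A] [NormedSpace ℂ A]
    {a b v : A} {c : ℂ} (hc : ‖a‖ + ‖b‖ < ‖c‖) (h : a * v - v * b = c • v) : v = 0 := by
  by_contra hv
  have hpos : 0 < ‖v‖ := norm_pos_iff.mpr hv
  have hle : ‖c‖ * ‖v‖ ≤ (‖a‖ + ‖b‖) * ‖v‖ := by
    calc ‖c‖ * ‖v‖ = ‖a * v - v * b‖ := by rw [h, norm_smul]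
      _ ≤ ‖a * v‖ + ‖v * b‖ := norm_sub_le _ _
      _ ≤ ‖a‖ * ‖v‖ + ‖v‖ * ‖b‖ := add_le_add (norm_mul_le _ _) (norm_mul_le _ _)
      _ = (‖a‖ + ‖b‖) * ‖v‖ := by ring
  exact absurd (le_of_mul_le_mul_right hle hpos) (not_le.mpr hc)

/-- If an automorphism of `M₂(A)` maps `diag(x, x + c)` to `diag(z, x + c)` for a scalar `c` that is
large compared with `x` and `z`, then `z` is unitarily equivalent to `x`. -/
theorem exists_unitary_conj_of_map_diagonal {A : Type*} [CStarAlgebra A] {x z : A} {c : ℂ}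
    (hxx : ‖x‖ + ‖x‖ < ‖c‖) (hzz : ‖z‖ + ‖z‖ < ‖c‖)
    (γ : Matrix (Fin 2) (Fin 2) A ≃⋆ₐ[ℂ] Matrix (Fin 2) (Fin 2) A)
    (hγ : γ (Matrix.diagonal ![x, x + c • 1]) = Matrix.diagonal ![z, x + c • 1]) :
    ∃ u ∈ unitary A, z = u * x * star u := by
  set e : Matrix (Fin 2) (Fin 2) A := !![0, 1; 0, 0] with he
  set V := γ e with hV
  have hcomm : Matrix.diagonal ![x, x + c • 1] * e - e * Matrix.diagonal ![x, x + c • 1]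
      = (-c) • e := by
    ext i j
    fin_cases i <;> fin_cases j <;> simp [he, Matrix.vecMul, dotProduct]
  have hunit : e * star e + star e * e = 1 := by
    ext i j
    fin_cases i <;> fin_cases j <;>
      simp [he, Matrix.mul_apply, Matrix.vecMul, dotProduct, Matrix.star_eq_conjTranspose]
  have hcommV : Matrix.diagonal ![z, x + c • 1] * V - V * Matrix.diagonal ![z, x + c • 1]
      = (-c) • V := by
    rw [← hγ, hV, ← map_mul, ← map_mul, ← map_sub, hcomm, map_smul]
  have hunitV : V * star V + star V * V = 1 := by
    rw [hV, ← map_star, ← map_mul, ← map_mul, ← map_add, hunit, map_one]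
  have h (i j : Fin 2) := congrFun (congrFun hcommV i) j
  have h00 : V 0 0 = 0 :=
    eq_zero_of_mul_sub_mul_eq_smul (a := z) (b := z) (c := -c) (by simpa using hzz)
      (by simpa using h 0 0)
  have h11 : V 1 1 = 0 :=
    eq_zero_of_mul_sub_mul_eq_smul (a := x) (b := x) (c := -c) (by simpa using hxx)
      (by simpa [add_mul, mul_add] using h 1 1)
  have h10 : V 1 0 = 0 := by
    refine eq_zero_of_mul_sub_mul_eq_smul (a := x) (b := z) (c := -c - c) ?_ ?_
    · rw [← neg_add', norm_neg, ← two_mul, norm_mul, Complex.norm_two]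
      linarith [norm_nonneg c]
    · have : x * V 1 0 + c • V 1 0 - V 1 0 * z = -(c • V 1 0) := by
        simpa [add_mul] using h 1 0
      rw [sub_smul, neg_smul, ← this]
      abel
  have h01 : z * V 0 1 = V 0 1 * x := by
    have : z * V 0 1 - (V 0 1 * x + c • V 0 1) = -(c • V 0 1) := by
      simpa [mul_add] using h 0 1
    rw [← sub_sub, sub_eq_add_neg, add_eq_right] at this
    exact sub_eq_zero.mp this
  have hu0 : V 0 1 * star (V 0 1) = 1 := by
    simpa [Matrix.mul_apply, Matrix.star_eq_conjTranspose, h00, h10, h11]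
      using congrFun (congrFun hunitV 0) 0
  have hu1 : star (V 0 1) * V 0 1 = 1 := by
    simpa [Matrix.mul_apply, Matrix.star_eq_conjTranspose, h00, h10, h11]
      using congrFun (congrFun hunitV 1) 1
  exact ⟨V 0 1, Unitary.mem_iff.mpr ⟨hu1, hu0⟩, by rw [← h01, mul_assoc, hu0, mul_one]⟩

/-- Unitary conjugation of the first diagonal entry extends to an automorphism of `M₂(A)`. -/
theorem exists_map_diagonal_of_mem_unitary {A : Type*} [CStarAlgebra A] {u : A}
    (hu : u ∈ unitary A) (x y : A) :
    ∃ γ : Matrix (Fin 2) (Fin 2) A ≃⋆ₐ[ℂ] Matrix (Fin 2) (Fin 2) A,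
      γ (Matrix.diagonal ![x, y]) = Matrix.diagonal ![u * x * star u, y] := by
  have hU : Matrix.diagonal ![u, 1] ∈ unitary (Matrix (Fin 2) (Fin 2) A) := by
    obtain ⟨h1, h2⟩ := Unitary.mem_iff.mp hu
    rw [Unitary.mem_iff]
    constructor <;> ext i j <;> fin_cases i <;> fin_cases j <;>
      simp [Matrix.mul_apply, Matrix.star_eq_conjTranspose, h1, h2]
  refine ⟨Unitary.conjStarAlgAut ℂ _ ⟨_, hU⟩, ?_⟩
  rw [Unitary.conjStarAlgAut_apply]
  ext i j
  fin_cases i <;> fin_cases j <;>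
    simp [Matrix.mul_apply, Matrix.star_eq_conjTranspose]

/-- **Theorem.** For an automorphism `θ` of a unital C*-algebra `A`, the following are
equivalent: (1) for all `x, y ∈ A` there is an automorphism `γ` of `M₂(A)` with
`γ(diag(x,y)) = diag(θ x, y)`; (2) `θ` is locally inner. -/
theorem diagonal_sum_iff_locallyInner (A : Type*) [CStarAlgebra A] (θ : A ≃⋆ₐ[ℂ] A) :
    (∀ x y : A,
      ∃ γ : Matrix (Fin 2) (Fin 2) A ≃⋆ₐ[ℂ] Matrix (Fin 2) (Fin 2) A,
        γ (Matrix.diagonal ![x, y]) = Matrix.diagonal ![θ x, y]) ↔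
    (∀ x : A, ∃ u ∈ unitary A, θ x = u * x * star u) := by
  constructor
  · intro h x
    have hθ : ‖θ x‖ = ‖x‖ := StarAlgEquiv.norm_map θ x
    obtain ⟨c, hc⟩ : ∃ c : ℂ, ‖x‖ + ‖x‖ < ‖c‖ := NormedField.exists_lt_norm ℂ _
    obtain ⟨γ, hγ⟩ := h x (x + c • 1)
    exact exists_unitary_conj_of_map_diagonal hc (by rwa [hθ]) γ hγ
  · intro h x y
    obtain ⟨u, hu, hx⟩ := h x
    rw [hx]
    exact exists_map_diagonal_of_mem_unitary hu x y
end

section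
/- Let θ be a *-automorphism of a unital C*-algebra A. If there exists a single *-automorphism γ of M₂(A) such that γ(diag(x, y)) = diag(θ(x), y) for ALL x, y ∈ A simultaneously, then θ is inner, i.e., there is a unitary u ∈ A with θ(x) = u x u* for all x ∈ A. -/
/-- **Remark.** If one single automorphism `γ` of `M₂(A)` satisfies
`γ(diag(x,y)) = diag(θ x, y)` for all `x, y ∈ A` simultaneously, then `θ` is inner. -/
theorem inner_of_global_diagonal_automorphism (A : Type*) [CStarAlgebra A]
    (θ : A ≃⋆ₐ[ℂ] A)
    (γ : Matrix (Fin 2) (Fin 2) A ≃⋆ₐ[ℂ] Matrix (Fin 2) (Fin 2) A)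
    (hγ : ∀ x y : A, γ (Matrix.diagonal ![x, y]) = Matrix.diagonal ![θ x, y]) :
    ∃ u ∈ unitary A, ∀ x : A, θ x = u * x * star u := by
  -- The image of the matrix unit `e₁₂` is supported in its upper right entry `u`.
  obtain ⟨E, hE⟩ : ∃ E : Matrix (Fin 2) (Fin 2) A, E = !![0, 1; 0, 0] := ⟨_, rfl⟩
  have intertwine (x : A) : Matrix.diagonal ![θ x, 0] * γ E = γ E * Matrix.diagonal ![0, x] := by
    have h : Matrix.diagonal ![x, 0] * E = E * Matrix.diagonal ![0, x] := by
      ext i j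
      fin_cases i <;> fin_cases j <;> simp [hE]
    simpa only [map_mul, hγ, map_zero] using congrArg γ h
  have left_support : Matrix.diagonal ![1, 0] * γ E = γ E := by
    have h : Matrix.diagonal ![1, 0] * E = E := by
      ext i j
      fin_cases i <;> fin_cases j <;> simp [hE]
    simpa only [map_mul, hγ, map_one] using congrArg γ h
  have right_support : γ E * Matrix.diagonal ![0, 1] = γ E := by
    have h : E * Matrix.diagonal ![0, 1] = E := by
      ext i j
      fin_cases i <;> fin_cases j <;> simp [hE]
    simpa only [map_mul, hγ, map_zero] using congrArg γ h
  have mul_star : γ E * star (γ E) = Matrix.diagonal ![1, 0] := by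
    have h : E * star E = Matrix.diagonal ![1, 0] := by
      ext i j
      fin_cases i <;> fin_cases j <;> simp [hE, Matrix.mul_apply, Matrix.star_apply]
    simpa only [map_mul, map_star, hγ, map_one] using congrArg γ h
  have star_mul : star (γ E) * γ E = Matrix.diagonal ![0, 1] := by
    have h : star E * E = Matrix.diagonal ![0, 1] := by
      ext i j
      fin_cases i <;> fin_cases j <;> simp [hE, Matrix.mul_apply, Matrix.star_apply]
    simpa only [map_mul, map_star, hγ, map_zero] using congrArg γ h
  have lower_right : γ E 1 1 = 0 := by
    simpa using (congrFun₂ left_support 1 1).symm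
  have upper_left : γ E 0 0 = 0 := by
    simpa using (congrFun₂ right_support 0 0).symm
  have hu_star_mul : star (γ E 0 1) * γ E 0 1 = 1 := by
    simpa [Matrix.mul_apply, Matrix.star_apply, lower_right] using congrFun₂ star_mul 1 1
  have hu_mul_star : γ E 0 1 * star (γ E 0 1) = 1 := by
    simpa [Matrix.mul_apply, Matrix.star_apply, upper_left] using congrFun₂ mul_star 0 0
  refine ⟨γ E 0 1, Unitary.mem_iff.mpr ⟨hu_star_mul, hu_mul_star⟩, fun x ↦ ?_⟩
  have h : θ x * γ E 0 1 = γ E 0 1 * x := by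
    simpa using congrFun₂ (intertwine x) 0 1
  rw [← h, mul_assoc, hu_mul_star, mul_one]
end

section
/- There exists a unital C*-algebra A such that every *-automorphism of A is locally inner, but not every *-automorphism of A is inner (i.e., A admits an outer automorphism). -/
open InnerProductSpace Filter Topology

theorem Orthonormal.exists_forall_inner_eq_zero {ι : Type*} [Uncountable ι] {H : Type*}
    [NormedAddCommGroup H] [InnerProductSpace ℂ H] {b : ι → H}
    (hb : Orthonormal ℂ b) {S : Set H} (hS : S.Countable) :
    ∃ i, ∀ s ∈ S, inner ℂ s (b i) = 0 := by
  have hs (s : H) : {i | inner ℂ s (b i) ≠ 0}.Countable := by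
    refine (hb.inner_products_summable (x := s)).countable_support.mono fun i hi ↦ ?_
    simpa [inner_eq_zero_symm] using hi
  have hc : (⋃ s ∈ S, {i | inner ℂ s (b i) ≠ 0}).Countable := hS.biUnion fun s _ ↦ hs s
  obtain ⟨i, hi⟩ := (Set.ne_univ_iff_exists_notMem (⋃ s ∈ S, {i | inner ℂ s (b i) ≠ 0})).1
    fun h ↦ Set.not_countable_univ (h ▸ hc)
  exact ⟨i, by simpa using hi⟩

section HilbertSpace

variable {H : Type*} [NormedAddCommGroup H] [InnerProductSpace ℂ H] [CompleteSpace H]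

/-- An automorphism of a star-subalgebra of `B(H)` that contains all rank-one operators
is implemented by a unitary of `H`. -/
theorem StarSubalgebra.exists_conjStarAlgEquiv_of_rankOne_mem [Nontrivial H]
    (A : StarSubalgebra ℂ (H →L[ℂ] H)) (hA : ∀ x y : H, rankOne ℂ x y ∈ A)
    (θ : A ≃⋆ₐ[ℂ] A) :
    ∃ U : H ≃ₗᵢ[ℂ] H, ∀ a : A, (θ a : H →L[ℂ] H) = U.conjStarAlgEquiv a := by
  obtain ⟨e, he⟩ := exists_norm_eq H zero_le_one
  let R : H → H → A := fun x y ↦ ⟨rankOne ℂ x y, hA x y⟩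
  have mul_R (a : A) (x y : H) : a * R x y = R ((a : H →L[ℂ] H) x) y := by
    ext z; simp [R]
  have star_R (x y : H) : star (R x y) = R y x := by
    apply Subtype.ext
    simp [R, ContinuousLinearMap.star_eq_adjoint]
  have R_mul_R (x y : H) : R y x * R x y = ((‖x‖ : ℂ) ^ 2) • R y y := by
    ext z; simp [R, smul_smul, mul_comm]
  have R_idem : R e e * R e e = R e e := by
    rw [R_mul_R]; simp [he]
  have hRe : R e e ≠ 0 := by
    intro h
    have := congrArg (fun a : A ↦ (a : H →L[ℂ] H)) h
    have he0 : e ≠ 0 := by rintro rfl; simp at he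
    simp [R, he0] at this
  have hq : θ (R e e) ≠ 0 := by simpa using hRe
  obtain ⟨f, hf1, hqf⟩ : ∃ f : H, ‖f‖ = 1 ∧ (θ (R e e) : H →L[ℂ] H) f = f := by
    obtain ⟨g, hg⟩ : ∃ g, (θ (R e e) : H →L[ℂ] H) g ≠ 0 := by
      by_contra! h
      exact hq (Subtype.ext (ContinuousLinearMap.ext h))
    set k := (θ (R e e) : H →L[ℂ] H) g with hk
    have hkk : (θ (R e e) : H →L[ℂ] H) k = k := by
      have := congrArg (fun a : A ↦ (θ a : H →L[ℂ] H) g) R_idem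
      simpa [map_mul] using this
    exact ⟨(‖k‖⁻¹ : ℂ) • k, by simp [norm_smul, hg], by simp [hkk]⟩
  let U₀ : H →ₗ[ℂ] H :=
    { toFun := fun x ↦ (θ (R x e) : H →L[ℂ] H) f
      map_add' := fun x y ↦ by
        have : R (x + y) e = R x e + R y e := by apply Subtype.ext; simp [R]
        simp [this]
      map_smul' := fun c x ↦ by
        have : R (c • x) e = c • R x e := by apply Subtype.ext; simp [R]
        simp [this] }
  have hU₀ (a : A) (x : H) : U₀ ((a : H →L[ℂ] H) x) = (θ a : H →L[ℂ] H) (U₀ x) := by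
    simp [U₀, ← mul_R]
  have hnorm (x : H) : ‖U₀ x‖ = ‖x‖ := by
    have key : (inner ℂ (U₀ x) (U₀ x) : ℂ) = (‖x‖ : ℂ) ^ 2 := by
      have h1 : star (θ (R x e)) * θ (R x e) = ((‖x‖ : ℂ) ^ 2) • θ (R e e) := by
        rw [← map_star, star_R, ← map_mul, R_mul_R, map_smul]
      have h2 := congrArg (fun a : A ↦ (a : H →L[ℂ] H) f) h1
      simp only [MulMemClass.coe_mul, StarMemClass.coe_star,
        ContinuousLinearMap.star_eq_adjoint, SetLike.val_smul, mul_apply_eq_comp,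
        smul_apply, hqf] at h2
      change inner ℂ ((θ (R x e) : H →L[ℂ] H) f) ((θ (R x e) : H →L[ℂ] H) f) = _
      rw [← ContinuousLinearMap.adjoint_inner_right, h2, inner_smul_right]
      simp [hf1]
    rw [inner_self_eq_norm_sq_to_K] at key
    have key' : ‖U₀ x‖ ^ 2 = ‖x‖ ^ 2 := by
      apply Complex.ofReal_injective
      push_cast
      exact key
    exact (pow_left_inj₀ (norm_nonneg _) (norm_nonneg _) two_ne_zero).1 key'
  have hsurj : Function.Surjective U₀ := fun y ↦ by
    refine ⟨(θ.symm (R y f) : H →L[ℂ] H) e, ?_⟩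
    have hUe : U₀ e = f := hqf
    rw [hU₀, hUe]
    simp [R, hf1]
  let U : H ≃ₗᵢ[ℂ] H := LinearIsometryEquiv.ofSurjective ⟨U₀, hnorm⟩ hsurj
  refine ⟨U, fun a ↦ ?_⟩
  ext y
  obtain ⟨x, rfl⟩ := U.surjective y
  have hUa : U ((a : H →L[ℂ] H) x) = (θ a : H →L[ℂ] H) (U x) := hU₀ a x
  simp [hUa]

/-- `T` and its adjoint act on the orthogonal complement of `S` as multiplication by `c` and
by its conjugate. -/
def IsScalarOff (S : Set H) (c : ℂ) (T : H →L[ℂ] H) : Prop :=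
  ∀ w : H, (∀ s ∈ S, inner ℂ s w = 0) → T w = c • w ∧ star T w = star c • w

namespace IsScalarOff

variable {S S' : Set H} {c d : ℂ} {T T' : H →L[ℂ] H}

theorem mono (h : IsScalarOff S c T) (hS : S ⊆ S') : IsScalarOff S' c T :=
  fun w hw ↦ h w fun s hs ↦ hw s (hS hs)

theorem add (h : IsScalarOff S c T) (h' : IsScalarOff S d T') :
    IsScalarOff S (c + d) (T + T') := fun w hw ↦ by
  simp [h w hw, h' w hw, add_smul]

theorem mul (h : IsScalarOff S c T) (h' : IsScalarOff S d T') :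
    IsScalarOff S (c * d) (T * T') := fun w hw ↦ by
  obtain ⟨h1, h2⟩ := h w hw
  obtain ⟨h1', h2'⟩ := h' w hw
  simp only [star_mul, mul_apply_eq_comp, h1', h2, map_smul, h1, h2', smul_smul]
  exact ⟨by rw [mul_comm], by rw [mul_comm]⟩

protected theorem star (h : IsScalarOff S c T) : IsScalarOff S (star c) (star T) := fun w hw ↦ by
  simpa using (h w hw).symm

theorem algebraMap (c : ℂ) : IsScalarOff S c (algebraMap ℂ (H →L[ℂ] H) c) := fun w _ ↦ by
  simp [Algebra.algebraMap_eq_smul_one]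

theorem rankOne (x y : H) : IsScalarOff {x, y} 0 (rankOne ℂ x y) := fun w hw ↦ by
  simp [ContinuousLinearMap.star_eq_adjoint, hw x (by simp), hw y (by simp)]

theorem conj (h : IsScalarOff S c T) (V : H ≃ₗᵢ[ℂ] H) :
    IsScalarOff (V '' S) c (V.conjStarAlgEquiv T) := fun w hw ↦ by
  have hw' : ∀ s ∈ S, inner ℂ s (V.symm w) = 0 := fun s hs ↦ by
    rw [← V.inner_map_map, V.apply_symm_apply]
    exact hw _ ⟨s, hs, rfl⟩
  rw [← map_star]
  simp [(h _ hw').1, (h _ hw').2]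

end IsScalarOff

variable (H) in
/-- The operators of the form `c • 1 + T` where `T` and its adjoint have separable range. -/
def scalarAddSeparable : StarSubalgebra ℂ (H →L[ℂ] H) where
  carrier := {T | ∃ S : Set H, S.Countable ∧ ∃ c, IsScalarOff S c T}
  mul_mem' := by
    rintro T T' ⟨S, hS, c, h⟩ ⟨S', hS', d, h'⟩
    exact ⟨S ∪ S', hS.union hS', c * d,
      (h.mono Set.subset_union_left).mul (h'.mono Set.subset_union_right)⟩
  add_mem' := by
    rintro T T' ⟨S, hS, c, h⟩ ⟨S', hS', d, h'⟩
    exact ⟨S ∪ S', hS.union hS', c + d,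
      (h.mono Set.subset_union_left).add (h'.mono Set.subset_union_right)⟩
  algebraMap_mem' c := ⟨∅, Set.countable_empty, c, .algebraMap c⟩
  star_mem' := by
    rintro T ⟨S, hS, c, h⟩
    exact ⟨S, hS, star c, h.star⟩

theorem rankOne_mem_scalarAddSeparable (x y : H) : rankOne ℂ x y ∈ scalarAddSeparable H :=
  ⟨{x, y}, Set.to_countable _, 0, .rankOne x y⟩

theorem conj_mem_scalarAddSeparable (V : H ≃ₗᵢ[ℂ] H) {T : H →L[ℂ] H}
    (hT : T ∈ scalarAddSeparable H) : V.conjStarAlgEquiv T ∈ scalarAddSeparable H := by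
  obtain ⟨S, hS, c, h⟩ := hT
  exact ⟨V '' S, hS.image V, c, h.conj V⟩

theorem isClosed_scalarAddSeparable
    (hH : ∀ S : Set H, S.Countable → ∃ w : H, w ≠ 0 ∧ ∀ s ∈ S, inner ℂ s w = 0) :
    IsClosed (scalarAddSeparable H : Set (H →L[ℂ] H)) := by
  refine IsSeqClosed.isClosed fun T T₀ hT hlim ↦ ?_
  choose S hS c h using hT
  have hc : (⋃ n, S n).Countable := Set.countable_iUnion hS
  have happ (w : H) : Tendsto (fun n ↦ T n w) atTop (𝓝 (T₀ w)) :=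
    ((ContinuousLinearMap.apply ℂ H w).continuous.tendsto T₀).comp hlim
  have happ' (w : H) : Tendsto (fun n ↦ star (T n) w) atTop (𝓝 (star T₀ w)) :=
    ((ContinuousLinearMap.apply ℂ H w).continuous.tendsto (star T₀)).comp hlim.star
  have hval (w : H) (hw : ∀ s ∈ ⋃ n, S n, inner ℂ s w = 0) (n : ℕ) :=
    (h n).mono (Set.subset_iUnion S n) w hw
  obtain ⟨w₀, hw₀, hw₀S⟩ := hH _ hc
  have hcl : Tendsto c atTop (𝓝 (inner ℂ w₀ (T₀ w₀) / inner ℂ w₀ w₀)) := by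
    have h1 : Tendsto (fun n ↦ inner ℂ w₀ (T n w₀) / inner ℂ w₀ w₀) atTop
        (𝓝 (inner ℂ w₀ (T₀ w₀) / inner ℂ w₀ w₀)) :=
      (tendsto_const_nhds.inner (happ w₀)).div_const _
    refine h1.congr fun n ↦ ?_
    rw [(hval w₀ hw₀S n).1, inner_smul_right, mul_div_cancel_right₀]
    exact inner_self_ne_zero.2 hw₀
  refine ⟨_, hc, inner ℂ w₀ (T₀ w₀) / inner ℂ w₀ w₀,
    fun w hw ↦ ⟨tendsto_nhds_unique (happ w) ?_, tendsto_nhds_unique (happ' w) ?_⟩⟩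
  · exact (hcl.smul_const w).congr fun n ↦ (hval w hw n).1.symm
  · exact (hcl.star.smul_const w).congr fun n ↦ (hval w hw n).2.symm

/-- Conjugation by a unitary of `H` agrees at each point of `scalarAddSeparable H` with
conjugation by a unitary in `scalarAddSeparable H`. -/
theorem exists_mem_scalarAddSeparable_conj_eq (U : H ≃ₗᵢ[ℂ] H) {T : H →L[ℂ] H}
    (hT : T ∈ scalarAddSeparable H) :
    ∃ u ∈ scalarAddSeparable H, u ∈ unitary (H →L[ℂ] H) ∧
      U.conjStarAlgEquiv T = u * T * star u := by
  obtain ⟨S, hS, c, h⟩ := hT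
  let S' : Set H := ⋃ n : ℤ, (U ^ n : H ≃ₗᵢ[ℂ] H) '' S
  have hS' : S'.Countable := Set.countable_iUnion fun n ↦ hS.image _
  have hSS' : S ⊆ S' := fun s hs ↦ Set.mem_iUnion.2 ⟨0, s, hs, by simp⟩
  let K : Submodule ℂ H := (Submodule.span ℂ S')ᗮ
  have memK {w : H} : w ∈ K ↔ ∀ s ∈ S', inner ℂ s w = 0 := by
    refine ⟨fun hw s hs ↦ hw s (Submodule.subset_span hs), fun hw v hv ↦ ?_⟩
    induction hv using Submodule.span_induction with
    | mem x hx => exact hw x hx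
    | zero => simp
    | add x y _ _ hx hy => simp [inner_add_left, hx, hy]
    | smul a x _ hx => simp [inner_smul_left, hx]
  have hpow (m : ℤ) {w : H} (hw : w ∈ K) : (U ^ m : H ≃ₗᵢ[ℂ] H) w ∈ K := by
    rw [memK] at hw ⊢
    rintro _ ⟨_, ⟨n, rfl⟩, s, hs, rfl⟩
    have : (U ^ n : H ≃ₗᵢ[ℂ] H) s = (U ^ m : H ≃ₗᵢ[ℂ] H) ((U ^ (n - m) : H ≃ₗᵢ[ℂ] H) s) := by
      change _ = (U ^ m * U ^ (n - m) : H ≃ₗᵢ[ℂ] H) s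
      rw [← zpow_add]; simp
    rw [this, LinearIsometryEquiv.inner_map_map]
    exact hw _ (Set.mem_iUnion.2 ⟨n - m, s, hs, rfl⟩)
  have hUK {w : H} (hw : w ∈ K) : U w ∈ K := by simpa using hpow 1 hw
  have hUK' {w : H} (hw : w ∈ K) : U.symm w ∈ K := by simpa using hpow (-1) hw
  have hUKo {w : H} (hw : w ∈ Kᗮ) : U w ∈ Kᗮ := fun k hk ↦ by
    rw [← U.apply_symm_apply k, U.inner_map_map]
    exact hw _ (hUK' hk)
  set Q : H →L[ℂ] H := K.starProjection with hQ
  set V : H →L[ℂ] H := (U : H →L[ℂ] H) with hV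
  have hVV : star V * V = 1 := by ext x; simp [V]
  have hVV' : V * star V = 1 := by ext x; simp [V]
  have hQQ : Q * Q = Q := K.isIdempotentElem_starProjection
  have hQs : star Q = Q := isSelfAdjoint_starProjection K
  have hVQ : Q * V = V * Q := by
    ext w
    refine Submodule.eq_starProjection_of_mem_orthogonal (hUK (K.starProjection_apply_mem w)) ?_
    have := hUKo (K.sub_starProjection_mem_orthogonal w)
    rwa [map_sub] at this
  have hVQ' : Q * star V = star V * Q := by
    have := congrArg star hVQ
    simpa [hQs] using this.symm
  have hQK (w : H) := (h.mono hSS') (Q w) (memK.1 (K.starProjection_apply_mem w))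
  have hTQ : T * Q = c • Q := by ext w; exact (hQK w).1
  have hQT : Q * T = c • Q := by
    have : star T * Q = star c • Q := by ext w; exact (hQK w).2
    simpa [hQs] using congrArg star this
  have hfix {w : H} (hw : w ∈ K) : Q w = w := K.starProjection_eq_self_iff.2 hw
  have V_mul_Q_mul (X : H →L[ℂ] H) : V * (Q * X) = Q * (V * X) := by
    rw [← mul_assoc, ← hVQ, mul_assoc]
  have starV_mul_Q_mul (X : H →L[ℂ] H) : star V * (Q * X) = Q * (star V * X) := by
    rw [← mul_assoc, ← hVQ', mul_assoc]
  have T_mul_Q_mul (X : H →L[ℂ] H) : T * (Q * X) = c • (Q * X) := by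
    rw [← mul_assoc, hTQ, smul_mul_assoc]
  have Q_mul_T_mul (X : H →L[ℂ] H) : Q * (T * X) = c • (Q * X) := by
    rw [← mul_assoc, hQT, smul_mul_assoc]
  have Q_mul_Q_mul (X : H →L[ℂ] H) : Q * (Q * X) = Q * X := by rw [← mul_assoc, hQQ]
  have Q_mul_V_mul_T_mul (X : H →L[ℂ] H) : Q * (V * (T * X)) = c • (Q * (V * X)) := by
    rw [← V_mul_Q_mul, Q_mul_T_mul, mul_smul_comm, V_mul_Q_mul]
  have star_u : star (V + (1 - V) * Q) = star V + (1 - star V) * Q := by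
    simp [hQs, sub_mul, hVQ']
  refine ⟨V + (1 - V) * Q, ⟨S', hS', 1, fun w hw ↦ ?_⟩, ?_, ?_⟩
  · rw [star_u]
    simp [hfix (memK.2 hw)]
  · rw [Unitary.mem_iff, star_u]
    constructor <;>
    · simp only [mul_add, add_mul, mul_sub, sub_mul, mul_assoc, mul_one, one_mul, hVV, hVV', hQQ,
        ← hVQ, ← hVQ', V_mul_Q_mul, starV_mul_Q_mul, Q_mul_Q_mul]
      abel
  · have hUT : U.conjStarAlgEquiv T = V * T * star V := by ext x; simp [V]
    rw [hUT, star_u]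
    simp only [mul_add, add_mul, mul_sub, sub_mul, mul_assoc, mul_one, one_mul, hVV', hQQ,
      ← hVQ, ← hVQ', hTQ, hQT, V_mul_Q_mul, T_mul_Q_mul, Q_mul_Q_mul, Q_mul_V_mul_T_mul,
      mul_smul_comm, smul_mul_assoc]
    abel

/-- A unitary of `H` with eigenvectors for the eigenvalues `1` and `-1` orthogonal to any given
countable set is not implemented by an element of `scalarAddSeparable H`. -/
theorem exists_conj_rankOne_ne (V : H ≃ₗᵢ[ℂ] H)
    (hV : ∀ S : Set H, S.Countable → ∃ w w' : H, w ≠ 0 ∧ w' ≠ 0 ∧ V w = w ∧ V w' = -w' ∧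
      (∀ s ∈ S, inner ℂ s w = 0) ∧ ∀ s ∈ S, inner ℂ s w' = 0)
    {u : H →L[ℂ] H} (hu : u ∈ scalarAddSeparable H) :
    ∃ x y : H, V.conjStarAlgEquiv (rankOne ℂ x y) ≠ u * rankOne ℂ x y * star u := by
  obtain ⟨S, hS, c, h⟩ := hu
  obtain ⟨w, w', hw0, hw0', hVw, hVw', hw, hw'⟩ := hV S hS
  have hsymm : V.symm w' = -w' := by rw [V.symm_apply_eq, map_neg, hVw', neg_neg]
  refine ⟨w, w', fun heq ↦ ?_⟩
  have := congrArg (fun a : H →L[ℂ] H ↦ a w') heq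
  simp only [LinearIsometryEquiv.conjStarAlgEquiv_apply_apply, hsymm,
    mul_apply_eq_comp, rankOne_apply, map_smul, (h w hw).1, (h w' hw').2, hVw,
    inner_neg_right, smul_smul] at this
  have hin : inner ℂ w' w' ≠ (0 : ℂ) := inner_self_ne_zero.2 hw0'
  have h1 := smul_left_injective ℂ hw0 this
  have h2 : star c * c = -1 := mul_right_cancel₀ hin (by linear_combination -h1)
  have h3 := congrArg Complex.re h2
  simp at h3
  nlinarith [mul_self_nonneg c.re, mul_self_nonneg c.im]

/-- An uncountable orthonormal family yields a unitary as in `exists_conj_rankOne_ne`. -/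
theorem exists_linearIsometryEquiv_eigenvectors {ι : Type*} [Uncountable ι] {b : Bool × ι → H}
    (hb : Orthonormal ℂ b) :
    ∃ V : H ≃ₗᵢ[ℂ] H, ∀ S : Set H, S.Countable → ∃ w w' : H, w ≠ 0 ∧ w' ≠ 0 ∧ V w = w ∧
      V w' = -w' ∧ (∀ s ∈ S, inner ℂ s w = 0) ∧ ∀ s ∈ S, inner ℂ s w' = 0 := by
  let K : Submodule ℂ H := (Submodule.span ℂ (Set.range fun i ↦ b (true, i)))ᗮ
  refine ⟨K.reflection, fun S hS ↦ ?_⟩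
  obtain ⟨i, hi⟩ := (hb.comp (fun i ↦ (false, i))
    (Prod.mk_right_injective false)).exists_forall_inner_eq_zero hS
  obtain ⟨j, hj⟩ := (hb.comp (fun i ↦ (true, i))
    (Prod.mk_right_injective true)).exists_forall_inner_eq_zero hS
  refine ⟨b (false, i), b (true, j), hb.ne_zero _, hb.ne_zero _,
    Submodule.reflection_mem_subspace_eq_self fun v hv ↦ ?_,
    Submodule.reflection_mem_subspace_orthogonalComplement_eq_neg
      (Submodule.le_orthogonal_orthogonal _ (Submodule.subset_span ⟨j, rfl⟩)), hi, hj⟩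
  induction hv using Submodule.span_induction with
  | mem x hx =>
    obtain ⟨k, rfl⟩ := hx
    exact hb.inner_eq_zero (by simp)
  | zero => simp
  | add x y _ _ hx hy => simp [inner_add_left, hx, hy]
  | smul a x _ hx => simp [inner_smul_left, hx]

variable (H) in
/-- Conjugation by a unitary of `H`, as an automorphism of `scalarAddSeparable H`. -/
noncomputable def scalarAddSeparable.conj (V : H ≃ₗᵢ[ℂ] H) :
    scalarAddSeparable H ≃⋆ₐ[ℂ] scalarAddSeparable H where
  toFun a := ⟨V.conjStarAlgEquiv a, conj_mem_scalarAddSeparable V a.2⟩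
  invFun a := ⟨V.conjStarAlgEquiv.symm a, conj_mem_scalarAddSeparable V.symm a.2⟩
  left_inv a := Subtype.ext (V.conjStarAlgEquiv.symm_apply_apply (a : H →L[ℂ] H))
  right_inv a := Subtype.ext (V.conjStarAlgEquiv.apply_symm_apply (a : H →L[ℂ] H))
  map_mul' a b := Subtype.ext (map_mul V.conjStarAlgEquiv (a : H →L[ℂ] H) b)
  map_add' a b := Subtype.ext (map_add V.conjStarAlgEquiv (a : H →L[ℂ] H) b)
  map_star' a := Subtype.ext (map_star V.conjStarAlgEquiv (a : H →L[ℂ] H))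
  map_smul' c a := Subtype.ext (map_smul V.conjStarAlgEquiv c (a : H →L[ℂ] H))

theorem scalarAddSeparable.exists_forall_eq_conj_apply [Nontrivial H]
    (θ : scalarAddSeparable H ≃⋆ₐ[ℂ] scalarAddSeparable H) (T : scalarAddSeparable H) :
    ∃ u ∈ unitary (scalarAddSeparable H), θ T = u * T * star u := by
  obtain ⟨U, hU⟩ := (scalarAddSeparable H).exists_conjStarAlgEquiv_of_rankOne_mem
    rankOne_mem_scalarAddSeparable θ
  obtain ⟨u, huA, hu, huT⟩ := exists_mem_scalarAddSeparable_conj_eq U T.2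
  rw [Unitary.mem_iff] at hu
  exact ⟨⟨u, huA⟩, Unitary.mem_iff.2 ⟨Subtype.ext hu.1, Subtype.ext hu.2⟩,
    Subtype.ext ((hU T).trans huT)⟩

theorem scalarAddSeparable.conj_ne (V : H ≃ₗᵢ[ℂ] H)
    (hV : ∀ S : Set H, S.Countable → ∃ w w' : H, w ≠ 0 ∧ w' ≠ 0 ∧ V w = w ∧ V w' = -w' ∧
      (∀ s ∈ S, inner ℂ s w = 0) ∧ ∀ s ∈ S, inner ℂ s w' = 0)
    (u : scalarAddSeparable H) :
    ¬ ∀ T : scalarAddSeparable H, scalarAddSeparable.conj H V T = u * T * star u := fun hu ↦ by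
  obtain ⟨x, y, hxy⟩ := exists_conj_rankOne_ne V hV u.2
  exact hxy (congrArg Subtype.val (hu ⟨_, rankOne_mem_scalarAddSeparable x y⟩))

theorem exists_cstarAlgebra_of_orthonormal {H : Type} [NormedAddCommGroup H]
    [InnerProductSpace ℂ H] [CompleteSpace H] {ι : Type*} [Uncountable ι] {b : Bool × ι → H}
    (hb : Orthonormal ℂ b) :
    ∃ (A : Type) (_ : CStarAlgebra A),
      (∀ θ : A ≃⋆ₐ[ℂ] A, ∀ x : A, ∃ u ∈ unitary A, θ x = u * x * star u) ∧
      ¬ (∀ θ : A ≃⋆ₐ[ℂ] A, ∃ u ∈ unitary A, ∀ x : A, θ x = u * x * star u) := by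
  obtain ⟨V, hV⟩ := exists_linearIsometryEquiv_eigenvectors hb
  have hH (S : Set H) (hS : S.Countable) : ∃ w : H, w ≠ 0 ∧ ∀ s ∈ S, inner ℂ s w = 0 := by
    obtain ⟨w, -, hw0, -, -, -, hw, -⟩ := hV S hS
    exact ⟨w, hw0, hw⟩
  have : Nontrivial H := (hH ∅ Set.countable_empty).elim fun w hw ↦ ⟨w, 0, hw.1⟩
  have hclosed : IsClosed (scalarAddSeparable H : Set (H →L[ℂ] H)) :=
    isClosed_scalarAddSeparable hH
  refine ⟨scalarAddSeparable H, StarSubalgebra.cstarAlgebra _ (h_closed := hclosed),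
    scalarAddSeparable.exists_forall_eq_conj_apply, fun hinner ↦ ?_⟩
  obtain ⟨u, -, hu⟩ := hinner (scalarAddSeparable.conj H V)
  exact scalarAddSeparable.conj_ne V hV u hu

end HilbertSpace


/-- **Proposition.** There is a unital C*-algebra on which all automorphisms are
locally inner, but not all automorphisms are inner. -/
theorem exists_cstarAlgebra_all_locallyInner_not_all_inner :
    ∃ (A : Type) (_ : CStarAlgebra A),
      (∀ θ : A ≃⋆ₐ[ℂ] A, ∀ x : A, ∃ u ∈ unitary A, θ x = u * x * star u) ∧
      ¬ (∀ θ : A ≃⋆ₐ[ℂ] A, ∃ u ∈ unitary A, ∀ x : A, θ x = u * x * star u) := by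
  let b : HilbertBasis (Bool × ℝ) ℂ (lp (fun _ : Bool × ℝ ↦ ℂ) 2) := .ofRepr (.refl ℂ _)
  exact exists_cstarAlgebra_of_orthonormal b.orthonormal
end

section
/- Let A be a unital C*-algebra, θ a *-automorphism of A, and x ∈ A with ‖x‖ < 1. If γ is a *-automorphism of M₂(A) satisfying γ(diag(x, x + 2·1)) = diag(θ(x), x + 2·1), then γ fixes the projection diag(0, 1): γ(diag(0, 1)) = diag(0, 1). -/
namespace Matrix

/-- Entries of matrices are dominated by the C⋆-norm, so ⋆-homomorphisms into matrices are
entrywise contractive. -/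
theorem norm_apply_starHom_le {A B n : Type*} [Fintype n] [CStarAlgebra A]
    [NonUnitalCStarAlgebra B] (φ : B →⋆ₙₐ[ℂ] Matrix n n A) (b : B) (i j : n) :
    ‖φ b i j‖ ≤ ‖b‖ := by
  let _ := CStarAlgebra.spectralOrder A
  have := CStarAlgebra.spectralOrderedRing A
  let ψ : B →⋆ₙₐ[ℂ] CStarMatrix n n A :=
    { toFun := fun b ↦ CStarMatrix.ofMatrix (φ b)
      map_smul' := fun c b ↦ map_smul φ c b
      map_zero' := map_zero φ
      map_add' := map_add φ
      map_mul' := map_mul φ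
      map_star' := map_star φ }
  exact CStarMatrix.norm_entry_le_norm.trans (NonUnitalStarAlgHom.norm_apply_le ψ b)

/-- A ⋆-automorphism of a matrix algebra is entrywise contractive on diagonal matrices. -/
theorem norm_starAlgEquiv_diagonal_apply_le {A n : Type*} [Fintype n] [DecidableEq n]
    [CStarAlgebra A] (γ : Matrix n n A ≃⋆ₐ[ℂ] Matrix n n A) (v : n → A) (i j : n) :
    ‖γ (diagonal v) i j‖ ≤ ‖v‖ := by
  let φ : (n → A) →⋆ₙₐ[ℂ] Matrix n n A :=
    { toFun := fun v ↦ γ (diagonal v)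
      map_smul' := fun c v ↦ by simp [diagonal_smul, map_smul]
      map_zero' := by simp
      map_add' := fun v w ↦ by rw [← map_add, diagonal_add]; rfl
      map_mul' := fun v w ↦ by rw [← map_mul, diagonal_mul_diagonal]; rfl
      map_star' := fun v ↦ by rw [← map_star, star_eq_conjTranspose, diagonal_conjTranspose] }
  exact norm_apply_starHom_le φ v i j

end Matrix

/-- An element that factors as `w k * t ^ k` for every `k`, with `‖w k‖ ≤ r ^ k` and
`r * ‖t‖ < 1`, vanishes. -/
theorem eq_zero_of_forall_eq_mul_pow {A : Type*} [NormedRing A] {a t : A} {w : ℕ → A} {r : ℝ}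
    (hr : 0 ≤ r) (hw : ∀ k, ‖w k‖ ≤ r ^ k) (hrt : r * ‖t‖ < 1)
    (ha : ∀ k, a = w k * t ^ k) : a = 0 := by
  have hlim := (tendsto_pow_atTop_nhds_zero_of_lt_one (by positivity) hrt).comp
    (Filter.tendsto_add_atTop_nat 1)
  rw [← norm_le_zero_iff]
  refine ge_of_tendsto' hlim fun k ↦ ?_
  calc ‖a‖ = ‖w (k + 1) * t ^ (k + 1)‖ := by rw [← ha]
    _ ≤ ‖w (k + 1)‖ * ‖t ^ (k + 1)‖ := norm_mul_le _ _
    _ ≤ r ^ (k + 1) * ‖t‖ ^ (k + 1) := by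
      gcongr
      · exact hw _
      · exact norm_pow_le' t k.succ_pos
    _ = (r * ‖t‖) ^ (k + 1) := (mul_pow _ _ _).symm

theorem CStarAlgebra.norm_one_le_one {A : Type*} [CStarAlgebra A] : ‖(1 : A)‖ ≤ 1 := by
  cases subsingleton_or_nontrivial A
  · simp [Subsingleton.elim (1 : A) 0]
  · exact CStarRing.norm_one.le

theorem CStarAlgebra.norm_pow_le_pow_norm {A : Type*} [CStarAlgebra A] (a : A) (k : ℕ) :
    ‖a ^ k‖ ≤ ‖a‖ ^ k := by
  cases k with
  | zero => simpa using CStarAlgebra.norm_one_le_one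
  | succ k => exact norm_pow_le' a k.succ_pos

/-- A translate by `2` of a strict contraction has a contractive inverse. -/
theorem exists_contractive_inverse_add_two {A : Type*} [CStarAlgebra A] {x : A} (hx : ‖x‖ < 1) :
    ∃ s : A, s * (x + 2) = 1 ∧ (x + 2) * s = 1 ∧ ‖s‖ ≤ 1 := by
  have hy : ‖-((2⁻¹ : ℂ) • x)‖ < 1 := by
    rw [norm_neg, norm_smul]
    norm_num
    linarith
  have htwo : (2 : A) = (2 : ℂ) • (1 : A) := by rw [← Algebra.algebraMap_eq_smul_one, map_ofNat]
  have hfac : x + 2 = (2 : ℂ) • (1 - -((2⁻¹ : ℂ) • x)) := by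
    rw [smul_sub, smul_neg, smul_smul, ← htwo]
    norm_num [add_comm]
  set u := Units.oneSub _ hy
  have hu : x + 2 = (2 : ℂ) • (u : A) := hfac
  have hleft : ((2⁻¹ : ℂ) • (↑u⁻¹ : A)) * (x + 2) = 1 := by
    rw [hu, smul_mul_smul_comm]; simp
  have hright : (x + 2) * ((2⁻¹ : ℂ) • (↑u⁻¹ : A)) = 1 := by
    rw [hu, smul_mul_smul_comm]; simp
  refine ⟨_, hleft, hright, ?_⟩
  generalize (2⁻¹ : ℂ) • (↑u⁻¹ : A) = s at *
  have hs : (2 : ℂ) • s = 1 - s * x := by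
    rw [← hleft, mul_add, htwo, mul_smul_comm, mul_one]; abel
  have hnorm : 2 * ‖s‖ ≤ 1 + ‖s‖ * ‖x‖ := calc
    2 * ‖s‖ = ‖1 - s * x‖ := by rw [← hs, norm_smul]; norm_num
    _ ≤ ‖(1 : A)‖ + ‖s * x‖ := norm_sub_le _ _
    _ ≤ 1 + ‖s‖ * ‖x‖ := add_le_add CStarAlgebra.norm_one_le_one (norm_mul_le _ _)
  nlinarith [norm_nonneg s]

/-- **Step in Theorem 3.4.** If `‖x‖ < 1` and `γ` is an automorphism of `M₂(A)` with
`γ(diag(x, x+2)) = diag(θ x, x+2)`, then `γ` fixes the projection `diag(0,1)`. -/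
theorem fixes_corner_projection (A : Type*) [CStarAlgebra A] (θ : A ≃⋆ₐ[ℂ] A)
    (x : A) (hx : ‖x‖ < 1)
    (γ : Matrix (Fin 2) (Fin 2) A ≃⋆ₐ[ℂ] Matrix (Fin 2) (Fin 2) A)
    (hγ : γ (Matrix.diagonal ![x, x + 2]) = Matrix.diagonal ![θ x, x + 2]) :
    γ (Matrix.diagonal ![0, 1]) = Matrix.diagonal ![0, 1] := by
  obtain ⟨s, hsl, hsr, hs⟩ := exists_contractive_inverse_add_two hx
  have hone : γ 1 = 1 := map_one γ
  have hpow (v : Fin 2 → A) (k : ℕ) (i : Fin 2) :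
      γ (Matrix.diagonal (v * ![x, x + 2] ^ k)) i i =
        γ (Matrix.diagonal v) i i * (![θ x, x + 2] i) ^ k := by
    have hγk : γ (Matrix.diagonal (![x, x + 2] ^ k)) = Matrix.diagonal (![θ x, x + 2] ^ k) := by
      rw [← Matrix.diagonal_pow, map_pow, hγ, Matrix.diagonal_pow]
    have hmul : Matrix.diagonal (v * ![x, x + 2] ^ k) =
        Matrix.diagonal v * Matrix.diagonal (![x, x + 2] ^ k) := by
      rw [Matrix.diagonal_mul_diagonal]; rfl
    rw [hmul, map_mul, hγk, Matrix.mul_diagonal, Pi.pow_apply]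
  have hθ : ‖θ x‖ ≤ ‖x‖ := NonUnitalStarAlgHom.norm_apply_le θ x
  have h00 : γ (Matrix.diagonal ![0, 1]) 0 0 = 0 := by
    refine eq_zero_of_forall_eq_mul_pow (t := θ x) (r := 1)
      (w := fun k ↦ γ (Matrix.diagonal ![0, s ^ k]) 0 0)
      zero_le_one (fun k ↦ ?_) (by linarith) fun k ↦ ?_
    · refine (Matrix.norm_starAlgEquiv_diagonal_apply_le γ _ 0 0).trans ?_
      rw [one_pow, pi_norm_le_iff_of_nonneg zero_le_one, Fin.forall_fin_two]
      exact ⟨by simp, (CStarAlgebra.norm_pow_le_pow_norm s k).trans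
        (pow_le_one₀ (norm_nonneg s) hs)⟩
    · have hv : ![0, s ^ k] * ![x, x + 2] ^ k = ![0, 1] := by
        ext i
        fin_cases i <;> simp [pow_mul_pow_eq_one k hsl]
      rw [← hv]
      exact hpow _ k 0
  have h11 : γ (Matrix.diagonal ![1, 0]) 1 1 = 0 := by
    refine eq_zero_of_forall_eq_mul_pow (t := s) (r := ‖x‖)
      (w := fun k ↦ γ (Matrix.diagonal ![x ^ k, 0]) 1 1)
      (norm_nonneg x) (fun k ↦ ?_) (by nlinarith [norm_nonneg x]) fun k ↦ ?_
    · refine (Matrix.norm_starAlgEquiv_diagonal_apply_le γ _ 1 1).trans ?_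
      rw [pi_norm_le_iff_of_nonneg (by positivity), Fin.forall_fin_two]
      exact ⟨CStarAlgebra.norm_pow_le_pow_norm x k, by simp⟩
    · have hv : ![x ^ k, 0] = ![1, 0] * ![x, x + 2] ^ k := by
        ext i
        fin_cases i <;> simp
      have hw := hpow ![1, 0] k 1
      rw [← hv] at hw
      change _ = _ * (x + 2) ^ k at hw
      rw [hw, mul_assoc, pow_mul_pow_eq_one k hsr, mul_one]
  have hsum : γ (Matrix.diagonal ![0, 1]) + γ (Matrix.diagonal ![1, 0]) = 1 := by
    rw [← map_add, Matrix.diagonal_add, ← hone, ← Matrix.diagonal_one]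
    congr 2
    ext i
    fin_cases i <;> simp
  have hidem : γ (Matrix.diagonal ![0, 1]) * γ (Matrix.diagonal ![0, 1]) =
      γ (Matrix.diagonal ![0, 1]) := by
    rw [← map_mul, Matrix.diagonal_mul_diagonal]
    congr 2
    ext i
    fin_cases i <;> simp
  have hself : star (γ (Matrix.diagonal ![0, 1])) = γ (Matrix.diagonal ![0, 1]) := by
    rw [← map_star, Matrix.star_eq_conjTranspose, Matrix.diagonal_conjTranspose]
    congr 2
    ext i
    fin_cases i <;> simp
  generalize γ (Matrix.diagonal ![0, 1]) = q at *
  have hq11 : q 1 1 = 1 := by simpa [h11] using congrFun₂ hsum 1 1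
  have hq10 : q 1 0 = star (q 0 1) := (congrFun₂ hself 1 0).symm
  have hq01 : q 0 1 = 0 := by
    have h := congrFun₂ hidem 0 0
    rw [Matrix.mul_apply, Fin.sum_univ_two, h00, hq10, mul_zero, zero_add] at h
    exact CStarRing.mul_star_self_eq_zero_iff _ |>.mp h
  ext i j
  fin_cases i <;> fin_cases j <;> simp [h00, hq11, hq10, hq01]
end

section
/- In the Calkin algebra C = B(ℓ²(ℕ))/K(ℓ²(ℕ)), the quotient of the bounded operators on ℓ²(ℕ) by the closed two-sided ideal of compact operators, there exists a family of 2^ℵ₀ (continuum many) pairwise orthogonal nonzero projections; that is, there is an injective map i ↦ p_i from a set of cardinality 2^ℵ₀ into C such that each p_i satisfies p_i* = p_i, p_i² = p_i, p_i ≠ 0, and p_i p_j = 0 whenever i ≠ j. -/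
/-- The restriction `f ↦ 1_S f` as a bounded operator on `ℓ²(ℕ)`. -/
noncomputable def coordProj (S : Set ℕ) :
    lp (fun _ : ℕ => ℂ) 2 →L[ℂ] lp (fun _ : ℕ => ℂ) 2 :=
  LinearMap.mkContinuous
    { toFun := fun f => ⟨S.indicator f, (lp.memℓp f).norm.mono fun n => by
        simpa using norm_indicator_le_norm_self (s := S) (f : ℕ → ℂ) n⟩
      map_add' := fun f g => by
        ext n
        exact congrFun (Set.indicator_add' S (f : ℕ → ℂ) (g : ℕ → ℂ)) n
      map_smul' := fun c f => by
        ext n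
        exact Set.indicator_const_smul_apply S c (f : ℕ → ℂ) n }
    1 fun f => by
      rw [one_mul]
      exact lp.norm_mono two_ne_zero fun n => norm_indicator_le_norm_self _ _

@[simp]
theorem coordProj_apply (S : Set ℕ) (f : lp (fun _ : ℕ => ℂ) 2) (n : ℕ) :
    coordProj S f n = S.indicator f n := rfl

theorem coordProj_mul (S T : Set ℕ) : coordProj S * coordProj T = coordProj (S ∩ T) := by
  ext f n
  by_cases hS : n ∈ S <;> by_cases hT : n ∈ T <;> simp [hS, hT]

theorem star_coordProj (S : Set ℕ) : star (coordProj S) = coordProj S := by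
  rw [ContinuousLinearMap.star_eq_adjoint, eq_comm, ContinuousLinearMap.eq_adjoint_iff]
  intro f g
  rw [lp.inner_eq_tsum, lp.inner_eq_tsum]
  refine tsum_congr fun n => ?_
  by_cases hS : n ∈ S <;> simp [hS]

theorem coordProj_single {S : Set ℕ} {n : ℕ} (hn : n ∈ S) :
    coordProj S (lp.single 2 n 1) = lp.single 2 n 1 := by
  ext m
  by_cases hm : m ∈ S
  · simp [hm]
  · have : m ≠ n := fun h => hm (h ▸ hn)
    simp [hm, this]

theorem isCompactOperator_coordProj_of_finite {S : Set ℕ} (hS : S.Finite) :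
    IsCompactOperator (coordProj S) := by
  have key : coordProj S = ∑ n ∈ hS.toFinset,
      (lp.singleContinuousLinearMap ℂ (fun _ : ℕ => ℂ) 2 n).comp
        (innerSL ℂ (lp.single 2 n (1 : ℂ) : lp (fun _ : ℕ => ℂ) 2)) := by
    ext f m
    have hcoe := congrFun (lp.coeFn_sum (fun n => lp.single (E := fun _ : ℕ => ℂ) 2 n (f n))
      hS.toFinset) m
    rw [Finset.sum_apply] at hcoe
    by_cases hm : m ∈ S <;>
      simp_all [lp.inner_single_left, Pi.single_apply]
  rw [key]
  refine (compactOperator (RingHom.id ℂ) (lp (fun _ : ℕ => ℂ) 2)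
    (lp (fun _ : ℕ => ℂ) 2)).sum_mem fun n _ => ?_
  exact (isCompactOperator_of_locallyCompactSpace_rng
    (lp.singleContinuousLinearMap ℂ (fun _ : ℕ => ℂ) 2 n)).comp_clm _

theorem not_isCompactOperator_coordProj_of_infinite {S : Set ℕ} (hS : S.Infinite) :
    ¬ IsCompactOperator (coordProj S) := by
  intro h
  obtain ⟨K, hK, hsub⟩ := IsCompactOperator.image_closedBall_subset_compact
    (f := (coordProj S : lp (fun _ : ℕ => ℂ) 2 →ₗ[ℂ] lp (fun _ : ℕ => ℂ) 2)) h 1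
  let e := hS.natEmbedding S
  have hmem (k : ℕ) : (lp.single 2 (e k : ℕ) 1 : lp (fun _ : ℕ => ℂ) 2) ∈ K := by
    refine hsub ⟨lp.single 2 (e k : ℕ) 1, ?_, coordProj_single (Subtype.prop _)⟩
    simp [lp.norm_single]
  obtain ⟨a, -, φ, hφ, hlim⟩ := hK.tendsto_subseq hmem
  obtain ⟨N, hN⟩ := Metric.cauchySeq_iff'.1 hlim.cauchySeq 1 one_pos
  have hlt := hN (N + 1) N.le_succ
  have hne : (e (φ (N + 1)) : ℕ) ≠ e (φ N) := fun h' =>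
    (hφ N.lt_succ_self).ne' (e.injective (Subtype.ext h'))
  rw [dist_eq_norm] at hlt
  have hle := lp.norm_apply_le_norm two_ne_zero
    ((lp.single 2 (e (φ (N + 1)) : ℕ) 1 : lp (fun _ : ℕ => ℂ) 2) -
      lp.single 2 (e (φ N) : ℕ) 1) (e (φ (N + 1)) : ℕ)
  simp [hne] at hle
  exact hlt.not_ge hle

/-- The set of codes of the finite initial segments of a binary sequence. -/
def initialSegmentCodes (x : ℕ → Bool) : Set ℕ :=
  Set.range fun n : ℕ => Encodable.encode (List.ofFn fun k : Fin n => x k)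

theorem initialSegmentCodes_infinite (x : ℕ → Bool) : (initialSegmentCodes x).Infinite := by
  refine Set.infinite_range_of_injective fun m n h => ?_
  simpa using congrArg List.length (Encodable.encode_injective h)

theorem initialSegmentCodes_inter_finite {x y : ℕ → Bool} (hxy : x ≠ y) :
    (initialSegmentCodes x ∩ initialSegmentCodes y).Finite := by
  obtain ⟨k, hk⟩ := Function.ne_iff.1 hxy
  refine ((Set.finite_Iic k).image
    fun n : ℕ => Encodable.encode (List.ofFn fun k : Fin n => x k)).subset ?_
  rintro _ ⟨⟨n, rfl⟩, ⟨m, hm⟩⟩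
  refine ⟨n, ?_, rfl⟩
  by_contra hn
  have hlist := Encodable.encode_injective hm
  obtain rfl : m = n := by simpa using congrArg List.length hlist
  exact hk (congrFun (List.ofFn_injective hlist) ⟨k, not_le.1 hn⟩).symm

/-- **Fact.** The Calkin algebra `C = B(ℓ²(ℕ))/K(ℓ²(ℕ))` contains a family of
`2^ℵ₀` pairwise orthogonal nonzero projections.  We phrase this via representatives
in `B(ℓ²(ℕ))`: there is a family `P i` of bounded operators, indexed by a set of
cardinality continuum, such that modulo the compact operators each `P i` is a
nonzero self-adjoint idempotent, `P i` and `P j` are orthogonal for `i ≠ j`, and the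
induced map into the Calkin algebra is injective. -/
theorem calkin_continuum_orthogonal_projections :
    ∃ (I : Type) (P : I → (lp (fun _ : ℕ => ℂ) 2 →L[ℂ] lp (fun _ : ℕ => ℂ) 2)),
      Cardinal.mk I = Cardinal.continuum ∧
      (∀ i : I, IsCompactOperator ⇑(P i - star (P i))) ∧
      (∀ i : I, IsCompactOperator ⇑(P i * P i - P i)) ∧
      (∀ i : I, ¬ IsCompactOperator ⇑(P i)) ∧
      (∀ i j : I, i ≠ j → IsCompactOperator ⇑(P i * P j)) ∧
      (∀ i j : I, i ≠ j → ¬ IsCompactOperator ⇑(P i - P j)) := by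
  have horth {x y : ℕ → Bool} (hxy : x ≠ y) : IsCompactOperator
      ⇑(coordProj (initialSegmentCodes x) * coordProj (initialSegmentCodes y)) := by
    rw [coordProj_mul]
    exact isCompactOperator_coordProj_of_finite (initialSegmentCodes_inter_finite hxy)
  refine ⟨ℕ → Bool, fun x => coordProj (initialSegmentCodes x), by simp, fun x => ?_, fun x => ?_,
    fun x => not_isCompactOperator_coordProj_of_infinite (initialSegmentCodes_infinite x),
    fun x y => horth, fun x y hxy h => ?_⟩
  · rw [star_coordProj, sub_self]
    exact isCompactOperator_zero
  · rw [coordProj_mul, Set.inter_self, sub_self]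
    exact isCompactOperator_zero
  · refine not_isCompactOperator_coordProj_of_infinite (initialSegmentCodes_infinite x) ?_
    have hsum := (h.clm_comp (coordProj (initialSegmentCodes x))).add (horth hxy)
    refine (congrArg IsCompactOperator (funext fun f => ?_)).mpr hsum
    ext n
    by_cases hn : n ∈ initialSegmentCodes x <;> simp [hn]
end

section
/- There exists an infinite-dimensional simple unital C*-algebra A admitting a faithful tracial state and a *-automorphism θ of A which is locally inner but not inner. -/
section TwistedGroupConstruction

open Submodule

/-- The nontrivial character of `ZMod 2`. -/
noncomputable def zmodTwoSign (a : ZMod 2) : ℂ := if a = 0 then 1 else -1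

@[simp] lemma zmodTwoSign_zero : zmodTwoSign 0 = 1 := if_pos rfl

@[simp] lemma zmodTwoSign_one : zmodTwoSign 1 = -1 := if_neg one_ne_zero

lemma zmodTwoSign_add (a b : ZMod 2) :
    zmodTwoSign (a + b) = zmodTwoSign a * zmodTwoSign b := by
  have key (a : ZMod 2) : a = 0 ∨ a = 1 := by revert a; decide
  have two : (1 + 1 : ZMod 2) = 0 := by decide
  rcases key a with rfl | rfl <;> rcases key b with rfl | rfl <;> simp [two]

@[simp] lemma zmodTwoSign_mul_self (a : ZMod 2) : zmodTwoSign a * zmodTwoSign a = 1 := by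
  rw [← zmodTwoSign_add, CharTwo.add_self_eq_zero, zmodTwoSign_zero]

@[simp] lemma norm_zmodTwoSign (a : ZMod 2) : ‖zmodTwoSign a‖ = 1 := by
  unfold zmodTwoSign; split_ifs <;> simp

/-- A C⋆-algebra generated by unitaries `U v` that multiply according to the sign cocycle
`B`, with a faithful contractive positive functional `τ` that vanishes on `U v` for `v ≠ 0`. -/
structure TwistedGroupSystem {V : Type*} [AddCommGroup V] (B : V →+ V →+ ZMod 2)
    (A : Type*) [CStarAlgebra A] where
  U : V → A
  U_mem_unitary (v : V) : U v ∈ unitary A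
  U_mul (v w : V) : U v * U w = zmodTwoSign (B w v) • U (v + w)
  mem_closure_span (x : A) : x ∈ closure (span ℂ (Set.range U) : Set A)
  τ : A →L[ℂ] ℂ
  τ_U_zero : τ (U 0) = 1
  τ_U_of_ne {v : V} (hv : v ≠ 0) : τ (U v) = 0
  norm_τ_le (x : A) : ‖τ x‖ ≤ ‖x‖
  τ_nonneg (x : A) : ∃ r : ℝ, 0 ≤ r ∧ τ (star x * x) = r
  τ_faithful (x : A) : τ (star x * x) = 0 → x = 0

namespace TwistedGroupSystem

variable {V : Type*} [AddCommGroup V] {B : V →+ V →+ ZMod 2} {A : Type*} [CStarAlgebra A]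
  (S : TwistedGroupSystem B A)
include S

lemma U_zero : S.U 0 = 1 := by
  have h : S.U 0 * S.U 0 = S.U 0 := by simpa using S.U_mul 0 0
  calc S.U 0 = star (S.U 0) * (S.U 0 * S.U 0) := by
        rw [← mul_assoc, Unitary.star_mul_self_of_mem (S.U_mem_unitary 0), one_mul]
    _ = 1 := by rw [h, Unitary.star_mul_self_of_mem (S.U_mem_unitary 0)]

lemma τ_one : S.τ 1 = 1 := by rw [← S.U_zero, S.τ_U_zero]

lemma nontrivial : Nontrivial A :=
  ⟨1, 0, fun h => by simpa [h] using S.τ_one⟩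

lemma U_ne_zero (v : V) : S.U v ≠ 0 := by
  have := S.nontrivial
  intro h
  simpa [h] using Unitary.star_mul_self_of_mem (S.U_mem_unitary v)

lemma U_mul_U_eq (v w : V) : S.U v * S.U w = zmodTwoSign (B v w + B w v) • (S.U w * S.U v) := by
  rw [S.U_mul v w, S.U_mul w v, smul_smul, add_comm w v, zmodTwoSign_add, mul_right_comm,
    zmodTwoSign_mul_self, one_mul]

lemma conj_U (v w : V) :
    S.U v * S.U w * star (S.U v) = zmodTwoSign (B v w + B w v) • S.U w := by
  rw [S.U_mul_U_eq, smul_mul_assoc, mul_assoc, Unitary.mul_star_self_of_mem (S.U_mem_unitary v),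
    mul_one]

/-- Every element is a limit of combinations of countably many of the generators. -/
lemma exists_countable_mem_closure_span (x : A) :
    ∃ C : Set V, C.Countable ∧ x ∈ closure (span ℂ (S.U '' C) : Set A) := by
  obtain ⟨y, hy, hyx⟩ := mem_closure_iff_seq_limit.1 (S.mem_closure_span x)
  have hfin (n : ℕ) : ∃ s : Finset V, y n ∈ span ℂ (S.U '' s) := by
    obtain ⟨g, hg⟩ := Finsupp.mem_span_range_iff_exists_finsupp.1 (hy n)
    exact ⟨g.support, hg ▸ sum_mem fun v hv => smul_mem _ _ (subset_span ⟨v, hv, rfl⟩)⟩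
  choose s hys using hfin
  refine ⟨⋃ n, s n, Set.countable_iUnion fun n => (s n).countable_toSet,
    mem_closure_iff_seq_limit.2 ⟨y, fun n => ?_, hyx⟩⟩
  exact span_mono (Set.image_mono (Set.subset_iUnion (fun n => (s n : Set V)) n)) (hys n)

lemma eqOn_closure_span {E : Type*} [AddCommGroup E] [Module ℂ E] [TopologicalSpace E] [T2Space E]
    {f g : A →ₗ[ℂ] E} (hf : Continuous f) (hg : Continuous g) {C : Set V}
    (h : ∀ v ∈ C, f (S.U v) = g (S.U v)) {x : A} (hx : x ∈ closure (span ℂ (S.U '' C) : Set A)) :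
    f x = g x := by
  have : Set.EqOn f g (span ℂ (S.U '' C)) :=
    LinearMap.eqOn_span (by rintro _ ⟨v, hv, rfl⟩; exact h v hv)
  exact this.closure hf hg hx

lemma hom_ext {E : Type*} [AddCommGroup E] [Module ℂ E] [TopologicalSpace E] [T2Space E]
    {f g : A →ₗ[ℂ] E} (hf : Continuous f) (hg : Continuous g)
    (h : ∀ v, f (S.U v) = g (S.U v)) (x : A) : f x = g x :=
  S.eqOn_closure_span hf hg (C := Set.univ) (fun v _ => h v)
    (by simpa using S.mem_closure_span x)

lemma τ_mul_comm (hV : ∀ v : V, v + v = 0) (x y : A) : S.τ (x * y) = S.τ (y * x) := by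
  have hU (v w : V) : S.τ (S.U v * S.U w) = S.τ (S.U w * S.U v) := by
    rw [S.U_mul, S.U_mul, map_smul, map_smul, add_comm w v]
    by_cases h : v + w = 0
    · rw [show w = v from add_left_cancel (h.trans (hV v).symm)]
    · simp [S.τ_U_of_ne h]
  have hx (v : V) (y : A) : S.τ (S.U v * y) = S.τ (y * S.U v) :=
    S.hom_ext (f := S.τ.toLinearMap ∘ₗ LinearMap.mulLeft ℂ (S.U v))
      (g := S.τ.toLinearMap ∘ₗ LinearMap.mulRight ℂ (S.U v))
      (S.τ.continuous.comp (continuous_const_mul _)) (S.τ.continuous.comp (continuous_mul_const _))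
      (fun w => hU v w) y
  exact S.hom_ext (f := S.τ.toLinearMap ∘ₗ LinearMap.mulRight ℂ y)
      (g := S.τ.toLinearMap ∘ₗ LinearMap.mulLeft ℂ y)
      (S.τ.continuous.comp (continuous_mul_const _)) (S.τ.continuous.comp (continuous_const_mul _))
      (fun v => hx v y) x

lemma linearIndependent_U (hV : ∀ v : V, v + v = 0) : LinearIndependent ℂ S.U := by
  rw [linearIndependent_iff']
  intro s g hg i hi
  have h := congrArg (fun z => S.τ (S.U i * z)) hg
  simp only [Finset.mul_sum, map_sum, mul_smul_comm, S.U_mul, map_smul, mul_zero, map_zero] at h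
  rw [Finset.sum_eq_single_of_mem i hi] at h
  · rw [hV, S.τ_U_zero] at h
    have h0 : zmodTwoSign (B i i) ≠ 0 := norm_ne_zero_iff.1 (by simp)
    simpa [h0] using h
  · intro j _ hj
    rw [S.τ_U_of_ne fun h0 => hj (add_left_cancel (h0.trans (hV i).symm))]
    simp

lemma not_finiteDimensional [Infinite V] (hV : ∀ v : V, v + v = 0) : ¬ FiniteDimensional ℂ A :=
  fun _ => not_finite_iff_infinite.2 ‹_› (S.linearIndependent_U hV).finite

/-- Averaging over conjugations by generators suppresses any finite set of nonzero frequencies. -/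
lemma exists_averaging (hB : ∀ v : V, v ≠ 0 → ∃ w, B w v + B v w = 1) (s : Finset V) :
    ∃ Φ : A →ₗ[ℂ] A, (∀ x, ‖Φ x‖ ≤ ‖x‖) ∧ (∀ I : TwoSidedIdeal A, ∀ x ∈ I, Φ x ∈ I) ∧
      ∃ t : V → ℂ, (∀ v, Φ (S.U v) = t v • S.U v) ∧ t 0 = 1 ∧ ∀ v ∈ s, v ≠ 0 → t v = 0 := by
  classical
  induction s using Finset.induction_on with
  | empty =>
    exact ⟨LinearMap.id, fun x => le_rfl, fun I x hx => hx, 1, fun v => by simp, rfl, by simp⟩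
  | insert a s _ ih =>
    obtain ⟨Φ, hΦ, hI, t, ht, ht0, hts⟩ := ih
    by_cases ha : a = 0
    · refine ⟨Φ, hΦ, hI, t, ht, ht0, fun v hv hv0 => hts v ?_ hv0⟩
      exact (Finset.mem_insert.1 hv).resolve_left fun h => hv0 (h.trans ha)
    obtain ⟨w, hw⟩ := hB a ha
    let Ψ : A →ₗ[ℂ] A := (2⁻¹ : ℂ) • (LinearMap.id +
      LinearMap.mulRight ℂ (star (S.U w)) ∘ₗ LinearMap.mulLeft ℂ (S.U w))
    have hΨ (x : A) : Ψ x = (2⁻¹ : ℂ) • (x + S.U w * x * star (S.U w)) := rfl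
    refine ⟨Ψ ∘ₗ Φ, fun x => ?_, fun I x hx => ?_,
      fun v => t v * (2⁻¹ * (1 + zmodTwoSign (B w v + B v w))), fun v => ?_, ?_, ?_⟩
    · refine le_trans ?_ (hΦ x)
      rw [LinearMap.comp_apply, hΨ, norm_smul]
      have h1 := norm_add_le (Φ x) (S.U w * Φ x * star (S.U w))
      rw [CStarRing.norm_mul_mem_unitary _ (Unitary.star_mem (S.U_mem_unitary w)),
        CStarRing.norm_mem_unitary_mul _ (S.U_mem_unitary w)] at h1
      norm_num
      linarith
    · rw [LinearMap.comp_apply, hΨ, ← smul_one_mul]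
      exact I.mul_mem_left _ _ (I.add_mem (hI I x hx)
        (I.mul_mem_right _ _ (I.mul_mem_left _ _ (hI I x hx))))
    · rw [LinearMap.comp_apply, ht, map_smul, hΨ, S.conj_U]
      module
    · norm_num [ht0]
    · intro v hv hv0
      rcases Finset.mem_insert.1 hv with rfl | hv
      · simp [hw]
      · simp [hts v hv hv0]

lemma eq_bot_or_eq_top (hB : ∀ v : V, v ≠ 0 → ∃ w, B w v + B v w = 1) (I : TwoSidedIdeal A) :
    I = ⊥ ∨ I = ⊤ := by
  refine or_iff_not_imp_left.2 fun hI => ?_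
  obtain ⟨x, hxI, hx⟩ : ∃ x ∈ I, x ≠ 0 := by
    by_contra! h
    exact hI (le_bot_iff.1 fun x hx => (TwoSidedIdeal.mem_bot A).2 (h x hx))
  obtain ⟨p, hpI, hp⟩ : ∃ p ∈ I, S.τ p = 1 := by
    have h0 : S.τ (star x * x) ≠ 0 := fun h => hx (S.τ_faithful x h)
    refine ⟨(S.τ (star x * x))⁻¹ • (star x * x), ?_, by simp [h0]⟩
    rw [← smul_one_mul]
    exact I.mul_mem_left _ _ (I.mul_mem_left _ _ hxI)
  obtain ⟨y, hy, hpy⟩ := Metric.mem_closure_iff.1 (S.mem_closure_span p) (1 / 2) (by norm_num)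
  obtain ⟨g, rfl⟩ := Finsupp.mem_span_range_iff_exists_finsupp.1 hy
  obtain ⟨Φ, hΦ, hΦI, t, ht, ht0, hts⟩ := S.exists_averaging hB g.support
  set y := g.sum fun v a => a • S.U v with hydef
  have hΦy : Φ y = S.τ y • 1 := by
    simp only [hydef, Finsupp.sum, map_sum, map_smul, Finset.sum_smul]
    refine Finset.sum_congr rfl fun v hv => ?_
    rcases eq_or_ne v 0 with rfl | hv0
    · rw [ht, ht0, S.τ_U_zero, S.U_zero]; simp
    · rw [ht, hts v hv hv0, S.τ_U_of_ne hv0]; simp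
  have h1 : ‖Φ p - S.τ y • 1‖ < 1 / 2 := by
    rw [← hΦy, ← map_sub]
    exact (hΦ _).trans_lt (by rwa [← dist_eq_norm])
  have h2 : ‖S.τ y • (1 : A) - 1‖ < 1 / 2 := by
    have := S.nontrivial
    have : S.τ y • (1 : A) - 1 = S.τ (y - p) • 1 := by rw [map_sub, hp, sub_smul, one_smul]
    rw [this, norm_smul, CStarRing.norm_one, mul_one]
    exact (S.norm_τ_le _).trans_lt (by rwa [← dist_eq_norm, dist_comm])
  have h3 : ‖1 - Φ p‖ < 1 := by
    rw [norm_sub_rev]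
    calc ‖Φ p - 1‖ = ‖(Φ p - S.τ y • 1) + (S.τ y • (1 : A) - 1)‖ := by congr 1; abel
      _ ≤ _ := norm_add_le _ _
      _ < 1 := by linarith
  have hu : IsUnit (Φ p) := by
    simpa using isUnit_one_sub_of_norm_lt_one h3
  obtain ⟨u, hu⟩ := hu
  rw [← TwoSidedIdeal.one_mem_iff, ← u.inv_mul, hu]
  exact I.mul_mem_left _ _ (hΦI I p hpI)

lemma exists_unitary_conj (χ : V →+ ZMod 2)
    (hχ : ∀ C : Set V, C.Countable → ∃ w, ∀ v ∈ C, B w v + B v w = χ v)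
    (θ : A ≃⋆ₐ[ℂ] A) (hθ : ∀ v, θ (S.U v) = zmodTwoSign (χ v) • S.U v) (x : A) :
    ∃ u ∈ unitary A, θ x = u * x * star u := by
  obtain ⟨C, hC, hx⟩ := S.exists_countable_mem_closure_span x
  obtain ⟨w, hw⟩ := hχ C hC
  refine ⟨S.U w, S.U_mem_unitary w, ?_⟩
  have hθc : Continuous θ := (StarAlgEquiv.isometry θ).continuous
  exact S.eqOn_closure_span (f := θ.toAlgEquiv.toLinearMap)
    (g := LinearMap.mulRight ℂ (star (S.U w)) ∘ₗ LinearMap.mulLeft ℂ (S.U w))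
    hθc ((continuous_mul_const _).comp (continuous_const_mul _))
    (fun v hv => by
      show θ (S.U v) = S.U w * S.U v * star (S.U w)
      rw [hθ, S.conj_U, hw v hv]) hx

lemma not_exists_unitary_forall_conj (χ : V →+ ZMod 2)
    (hχ : ∀ C : Set V, C.Countable → ∃ v, χ v = 1 ∧ ∀ w ∈ C, B v w + B w v = 0)
    (θ : A ≃⋆ₐ[ℂ] A) (hθ : ∀ v, θ (S.U v) = zmodTwoSign (χ v) • S.U v) :
    ¬ ∃ u ∈ unitary A, ∀ x : A, θ x = u * x * star u := by
  rintro ⟨u, hu, hux⟩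
  obtain ⟨C, hC, huC⟩ := S.exists_countable_mem_closure_span u
  obtain ⟨v, hv, hvC⟩ := hχ C hC
  have hcomm : S.U v * u = u * S.U v :=
    S.eqOn_closure_span (f := LinearMap.mulLeft ℂ (S.U v)) (g := LinearMap.mulRight ℂ (S.U v))
      (continuous_const_mul _) (continuous_mul_const _)
      (fun w hw => by
        show S.U v * S.U w = S.U w * S.U v
        rw [S.U_mul_U_eq, hvC w hw, zmodTwoSign_zero, one_smul]) huC
  have h := hux (S.U v)
  rw [hθ, hv, ← hcomm, mul_assoc, Unitary.mul_star_self_of_mem hu, mul_one, zmodTwoSign_one,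
    neg_one_smul] at h
  have h2 : (2 : ℂ) • S.U v = 0 := by
    rw [two_smul]
    nth_rewrite 1 [← h]
    exact neg_add_cancel _
  exact S.U_ne_zero v ((smul_eq_zero.1 h2).resolve_left two_ne_zero)

end TwistedGroupSystem

/-- The Hilbert space `ℓ²(V)`. -/
noncomputable abbrev EllTwo (V : Type*) := lp (fun _ : V => ℂ) 2

section SignedTranslation

variable {V : Type*} [AddCommGroup V]

/-- The isometry `f ↦ (u ↦ ± f (u + v))` of `ℓ²(V)`, with signs prescribed by `κ`. -/
noncomputable def signedTranslation (κ : V → ZMod 2) (v : V) :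
    EllTwo V →ₗᵢ[ℂ] EllTwo V where
  toFun f := ⟨fun u => zmodTwoSign (κ u) * f (u + v), by
    have h := (lp.memℓp f).summable (by norm_num)
    exact memℓp_gen (by simpa [Function.comp_def] using (Equiv.addRight v).summable_iff.2 h)⟩
  map_add' f g := by ext u; exact mul_add _ _ _
  map_smul' a f := by ext u; exact mul_left_comm _ _ _
  norm_map' f := by
    rw [lp.norm_eq_tsum_rpow (by norm_num), lp.norm_eq_tsum_rpow (by norm_num)]
    congr 1
    simpa using (Equiv.addRight v).tsum_eq fun u => ‖f u‖ ^ (2 : ENNReal).toReal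

/-- `signedTranslation` as a bounded operator. -/
noncomputable def signedTranslationCLM (κ : V → ZMod 2) (v : V) :
    EllTwo V →L[ℂ] EllTwo V :=
  (signedTranslation κ v).toContinuousLinearMap

@[simp] lemma signedTranslationCLM_apply (κ : V → ZMod 2) (v : V) (f : EllTwo V)
    (u : V) : signedTranslationCLM κ v f u = zmodTwoSign (κ u) * f (u + v) := rfl

lemma star_signedTranslationCLM_mul_self (κ : V → ZMod 2) (v : V) :
    star (signedTranslationCLM κ v) * signedTranslationCLM κ v = 1 :=
  (ContinuousLinearMap.norm_map_iff_adjoint_comp_self _).1 (signedTranslation κ v).norm_map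

lemma signedTranslationCLM_mul (κ κ' : V → ZMod 2) (v v' : V) :
    signedTranslationCLM κ v * signedTranslationCLM κ' v' =
      signedTranslationCLM (fun u => κ u + κ' (u + v)) (v + v') := by
  ext f u
  simp [zmodTwoSign_add, mul_assoc, add_assoc]

end SignedTranslation

section TwistedGroupAlgebra

variable {V : Type*} [AddCommGroup V]

/-- The twisted translation operators on `ℓ²(V)`. -/
noncomputable def weylOperator (B : V →+ V →+ ZMod 2) (v : V) :
    EllTwo V →L[ℂ] EllTwo V :=
  signedTranslationCLM (B v) v

lemma weylOperator_mul (B : V →+ V →+ ZMod 2) (v w : V) :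
    weylOperator B v * weylOperator B w = zmodTwoSign (B w v) • weylOperator B (v + w) := by
  ext f u
  simp [weylOperator, zmodTwoSign_add, add_assoc]
  ring

lemma weylOperator_zero (B : V →+ V →+ ZMod 2) : weylOperator B 0 = 1 := by
  ext f u
  simp [weylOperator]

lemma star_weylOperator_mul_self (B : V →+ V →+ ZMod 2) (v : V) :
    star (weylOperator B v) * weylOperator B v = 1 :=
  star_signedTranslationCLM_mul_self _ _

lemma star_weylOperator (B : V →+ V →+ ZMod 2) (hV : ∀ v : V, v + v = 0) (v : V) :
    star (weylOperator B v) = zmodTwoSign (B v v) • weylOperator B v := by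
  have h : weylOperator B v * (zmodTwoSign (B v v) • weylOperator B v) = 1 := by
    rw [mul_smul_comm, weylOperator_mul, smul_smul, zmodTwoSign_mul_self, one_smul, hV,
      weylOperator_zero]
  calc star (weylOperator B v)
      = star (weylOperator B v) * (weylOperator B v * (zmodTwoSign (B v v) • weylOperator B v)) := by
        rw [h, mul_one]
    _ = _ := by
        rw [← mul_assoc, star_weylOperator_mul_self, one_mul]

lemma weylOperator_mem_unitary (B : V →+ V →+ ZMod 2) (hV : ∀ v : V, v + v = 0) (v : V) :
    weylOperator B v ∈ unitary (EllTwo V →L[ℂ] EllTwo V) := by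
  refine Unitary.mem_iff.2 ⟨star_weylOperator_mul_self B v, ?_⟩
  rw [star_weylOperator B hV, mul_smul_comm, weylOperator_mul, smul_smul, zmodTwoSign_mul_self,
    one_smul, hV, weylOperator_zero]

/-- The reduced twisted group C⋆-algebra of `V` for the sign cocycle `B`. -/
noncomputable def twistedGroupAlgebra (B : V →+ V →+ ZMod 2) (hV : ∀ v : V, v + v = 0) :
    StarSubalgebra ℂ (EllTwo V →L[ℂ] EllTwo V) :=
  StarSubalgebra.topologicalClosure
    { Submodule.toSubalgebra (span ℂ (Set.range (weylOperator B)))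
        (subset_span ⟨0, weylOperator_zero B⟩)
        (fun x y hx hy => by
          have := Submodule.mul_mem_mul hx hy
          rw [span_mul_span] at this
          refine span_le.2 ?_ this
          rintro _ ⟨_, ⟨v, rfl⟩, _, ⟨w, rfl⟩, rfl⟩
          change weylOperator B v * weylOperator B w ∈ _
          rw [weylOperator_mul]
          exact smul_mem _ _ (subset_span ⟨_, rfl⟩)) with
      star_mem' := fun {x} hx => by
        change star x ∈ span ℂ (Set.range (weylOperator B))
        replace hx : x ∈ span ℂ (Set.range (weylOperator B)) := hx
        induction hx using span_induction with
        | mem x hx =>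
          obtain ⟨v, rfl⟩ := hx
          rw [star_weylOperator B hV]
          exact smul_mem _ _ (subset_span ⟨_, rfl⟩)
        | zero => simp
        | add x y _ _ hx hy => rw [star_add]; exact add_mem hx hy
        | smul a x _ hx => rw [star_smul]; exact smul_mem _ _ hx }

variable (B : V →+ V →+ ZMod 2) (hV : ∀ v : V, v + v = 0)

instance : IsClosed
    ((twistedGroupAlgebra B hV : StarSubalgebra ℂ (EllTwo V →L[ℂ] EllTwo V)) :
      Set (EllTwo V →L[ℂ] EllTwo V)) :=
  StarSubalgebra.isClosed_topologicalClosure _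

lemma weylOperator_mem (v : V) : weylOperator B v ∈ twistedGroupAlgebra B hV :=
  subset_closure (subset_span ⟨v, rfl⟩)

open Classical in
/-- The unit vector at the origin of `ℓ²(V)`. -/
noncomputable def originVector (V : Type*) [AddCommGroup V] : EllTwo V :=
  lp.single 2 0 1

open Classical in
lemma originVector_apply (v : V) : originVector V v = if v = 0 then 1 else 0 := by
  simp [originVector, Pi.single_apply]

lemma norm_originVector : ‖originVector V‖ = 1 := by
  classical
  simp [originVector, lp.norm_single]

lemma eq_zero_of_apply_originVector_eq_zero
    {x : EllTwo V →L[ℂ] EllTwo V} (hx : x ∈ twistedGroupAlgebra B hV)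
    (h : x (originVector V) = 0) : x = 0 := by
  classical
  have hcomm (v : V) : x * signedTranslationCLM (fun u => B u v) v =
      signedTranslationCLM (fun u => B u v) v * x := by
    set R := signedTranslationCLM (fun u => B u v) v with hR
    have key : Set.EqOn (LinearMap.mulRight ℂ R) (LinearMap.mulLeft ℂ R)
        (span ℂ (Set.range (weylOperator B))) := by
      refine LinearMap.eqOn_span ?_
      rintro _ ⟨w, rfl⟩
      change weylOperator B w * R = R * weylOperator B w
      rw [hR, weylOperator, signedTranslationCLM_mul, signedTranslationCLM_mul, add_comm w v]
      congr 1
      ext u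
      simp only [map_add, AddMonoidHom.add_apply]
      abel
    exact key.closure (continuous_mul_const R) (continuous_const_mul R) hx
  refine lp.ext_continuousLinearMap (by norm_num) fun v => ?_
  ext1
  have hsingle : lp.single (E := fun _ : V => ℂ) 2 v 1 =
      zmodTwoSign (B v (-v)) • signedTranslationCLM (fun u => B u (-v)) (-v) (originVector V) := by
    ext u
    rcases eq_or_ne u v with rfl | hu
    · simp [originVector_apply, -map_neg]
    · have : u + -v ≠ 0 := fun h => hu (by simpa using eq_neg_of_add_eq_zero_left h)
      simp [originVector_apply, this, hu]
  have hxv : x (lp.single (E := fun _ : V => ℂ) 2 v 1) = 0 := by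
    rw [hsingle, map_smul]
    have := DFunLike.congr_fun (hcomm (-v)) (originVector V)
    simp only [mul_apply_eq_comp] at this
    rw [this, h, map_zero, smul_zero]
  simpa using hxv

/-- The twisted group algebra with its canonical generators and trace. -/
noncomputable def twistedGroupSystem : TwistedGroupSystem B (twistedGroupAlgebra B hV) where
  U v := ⟨weylOperator B v, weylOperator_mem B hV v⟩
  U_mem_unitary v := by
    have h := Unitary.mem_iff.1 (weylOperator_mem_unitary B hV v)
    exact Unitary.mem_iff.2 ⟨Subtype.ext h.1, Subtype.ext h.2⟩
  U_mul v w := Subtype.ext (weylOperator_mul B v w)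
  mem_closure_span x := by
    rw [Topology.IsInducing.subtypeVal.closure_eq_preimage_closure_image, Set.mem_preimage]
    have h : Subtype.val '' (span ℂ (Set.range fun v : V =>
        (⟨weylOperator B v, weylOperator_mem B hV v⟩ : twistedGroupAlgebra B hV)) :
          Set (twistedGroupAlgebra B hV)) =
        (span ℂ (Set.range (weylOperator B)) : Set (EllTwo V →L[ℂ] EllTwo V)) := by
      have := congrArg (fun p : Submodule ℂ (EllTwo V →L[ℂ] EllTwo V) =>
          (p : Set (EllTwo V →L[ℂ] EllTwo V)))
        (Submodule.map_span (twistedGroupAlgebra B hV).subtype.toAlgHom.toLinearMap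
          (Set.range fun v : V =>
            (⟨weylOperator B v, weylOperator_mem B hV v⟩ : twistedGroupAlgebra B hV)))
      rw [← Set.range_comp] at this
      exact this
    exact (congrArg (fun s => x.1 ∈ closure s) h).mpr x.2
  τ :=
    { toFun := fun x => inner ℂ (originVector V) (x.1 (originVector V))
      map_add' := fun x y => by simp
      map_smul' := fun a x => by simp
      cont := by fun_prop }
  τ_U_zero := by
    change inner ℂ (originVector V) (weylOperator B 0 (originVector V)) = 1
    rw [weylOperator_zero, one_apply_eq_self, inner_self_eq_norm_sq_to_K,
      norm_originVector]
    simp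
  τ_U_of_ne {v} hv := by
    classical
    change inner ℂ (originVector V) (weylOperator B v (originVector V)) = 0
    rw [show originVector V = lp.single 2 0 1 from lp.ext (funext fun u => by
      simp [originVector_apply, Pi.single_apply]), lp.inner_single_left]
    simp [weylOperator, hv]
  norm_τ_le x := by
    change ‖inner ℂ (originVector V) (x.1 (originVector V))‖ ≤ ‖x.1‖
    refine (norm_inner_le_norm _ _).trans ?_
    simpa [norm_originVector] using x.1.le_opNorm (originVector V)
  τ_nonneg x := by
    refine ⟨‖x.1 (originVector V)‖ ^ 2, by positivity, ?_⟩
    change inner ℂ (originVector V) ((star x.1 * x.1) (originVector V)) = _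
    rw [mul_apply_eq_comp, ContinuousLinearMap.star_eq_adjoint,
      ContinuousLinearMap.adjoint_inner_right, inner_self_eq_norm_sq_to_K]
    simp
  τ_faithful x h := by
    replace h : inner ℂ (originVector V) ((star x.1 * x.1) (originVector V)) = 0 := h
    rw [mul_apply_eq_comp, ContinuousLinearMap.star_eq_adjoint,
      ContinuousLinearMap.adjoint_inner_right, inner_self_eq_zero] at h
    exact Subtype.ext (eq_zero_of_apply_originVector_eq_zero B hV x.2 h)

/-- The diagonal sign operator on `ℓ²(V)` given by a character. -/
noncomputable def characterOperator (χ : V →+ ZMod 2) : EllTwo V →L[ℂ] EllTwo V :=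
  signedTranslationCLM χ 0

lemma characterOperator_mul_self (χ : V →+ ZMod 2) :
    characterOperator χ * characterOperator χ = 1 := by
  ext f u
  simp [characterOperator, ← mul_assoc]

lemma characterOperator_conj_conj (χ : V →+ ZMod 2) (x : EllTwo V →L[ℂ] EllTwo V) :
    characterOperator χ * (characterOperator χ * x * characterOperator χ) * characterOperator χ =
      x := by
  calc _ = characterOperator χ * characterOperator χ * x *
        (characterOperator χ * characterOperator χ) := by simp only [mul_assoc]
    _ = x := by rw [characterOperator_mul_self, one_mul, mul_one]

lemma star_characterOperator (χ : V →+ ZMod 2) :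
    star (characterOperator χ) = characterOperator χ := by
  have h : star (characterOperator χ) * characterOperator χ = 1 :=
    star_signedTranslationCLM_mul_self _ _
  calc star (characterOperator χ)
      = star (characterOperator χ) * (characterOperator χ * characterOperator χ) := by
        rw [characterOperator_mul_self, mul_one]
    _ = characterOperator χ := by rw [← mul_assoc, h, one_mul]

lemma characterOperator_conj_weylOperator (χ : V →+ ZMod 2) (v : V) :
    characterOperator χ * weylOperator B v * characterOperator χ =
      zmodTwoSign (χ v) • weylOperator B v := by
  ext f u
  have h := zmodTwoSign_mul_self (χ u)
  simp only [characterOperator, weylOperator, mul_apply_eq_comp,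
    signedTranslationCLM_apply, add_zero, map_add, zmodTwoSign_add, _root_.smul_apply,
    lp.coeFn_smul, Pi.smul_apply, smul_eq_mul]
  linear_combination zmodTwoSign (B v u) * zmodTwoSign (χ v) * f (u + v) * h

lemma characterOperator_conj_mem (χ : V →+ ZMod 2) {x : EllTwo V →L[ℂ] EllTwo V}
    (hx : x ∈ twistedGroupAlgebra B hV) :
    characterOperator χ * x * characterOperator χ ∈ twistedGroupAlgebra B hV := by
  let Φ : (EllTwo V →L[ℂ] EllTwo V) →ₗ[ℂ] (EllTwo V →L[ℂ] EllTwo V) :=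
    LinearMap.mulRight ℂ (characterOperator χ) ∘ₗ LinearMap.mulLeft ℂ (characterOperator χ)
  have hΦ : Continuous Φ :=
    (continuous_mul_const (characterOperator χ)).comp (continuous_const_mul (characterOperator χ))
  refine map_mem_closure (f := Φ) hΦ hx fun y hy => ?_
  have : span ℂ (Set.range (weylOperator B)) ≤ (span ℂ (Set.range (weylOperator B))).comap Φ := by
    refine span_le.2 ?_
    rintro _ ⟨v, rfl⟩
    change characterOperator χ * weylOperator B v * characterOperator χ ∈
      span ℂ (Set.range (weylOperator B))
    rw [characterOperator_conj_weylOperator]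
    exact smul_mem _ _ (subset_span ⟨v, rfl⟩)
  exact this hy

/-- The automorphism of the twisted group algebra dual to a character. -/
noncomputable def dualAutomorphism (χ : V →+ ZMod 2) :
    twistedGroupAlgebra B hV ≃⋆ₐ[ℂ] twistedGroupAlgebra B hV where
  toFun x := ⟨_, characterOperator_conj_mem B hV χ x.2⟩
  invFun x := ⟨_, characterOperator_conj_mem B hV χ x.2⟩
  left_inv x := Subtype.ext (characterOperator_conj_conj χ x.1)
  right_inv x := Subtype.ext (characterOperator_conj_conj χ x.1)
  map_mul' x y := Subtype.ext <| by
    change characterOperator χ * (x.1 * y.1) * characterOperator χ =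
      characterOperator χ * x.1 * characterOperator χ *
        (characterOperator χ * y.1 * characterOperator χ)
    calc _ = characterOperator χ * x.1 * 1 * y.1 * characterOperator χ := by
          simp only [mul_one, mul_assoc]
      _ = _ := by rw [← characterOperator_mul_self χ]; simp only [mul_assoc]
  map_add' x y := Subtype.ext <| by
    change characterOperator χ * (x.1 + y.1) * characterOperator χ = _
    rw [mul_add, add_mul]
    rfl
  map_star' x := Subtype.ext <| by
    change characterOperator χ * star x.1 * characterOperator χ =
      star (characterOperator χ * x.1 * characterOperator χ)
    simp only [star_mul, star_characterOperator, mul_assoc]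
  map_smul' a x := Subtype.ext <| by
    change characterOperator χ * (a • x.1) * characterOperator χ = _
    rw [mul_smul_comm, smul_mul_assoc]
    rfl

lemma dualAutomorphism_U (χ : V →+ ZMod 2) (v : V) :
    dualAutomorphism B hV χ ((twistedGroupSystem B hV).U v) =
      zmodTwoSign (χ v) • (twistedGroupSystem B hV).U v :=
  Subtype.ext (characterOperator_conj_weylOperator B χ v)

end TwistedGroupAlgebra

section CountableSupport

variable (X : Type*)

/-- The functions `X → ZMod 2` of countable support. -/
def countablySupported : AddSubgroup (X → ZMod 2) where
  carrier := {b | b.support.Countable}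
  zero_mem' := by simp
  add_mem' {a b} ha hb := (Set.Countable.union ha hb).mono (Function.support_add a b)
  neg_mem' {a} ha := by simpa [Function.support_neg] using ha

/-- Pairs of a finitely supported and a countably supported function `X → ZMod 2`. -/
abbrev FinCountablePair := (X →₀ ZMod 2) × countablySupported X

variable {X}

/-- The pairing of the finitely supported part of `v` with the countably supported part of `w`. -/
noncomputable def finCountablePairing :
    FinCountablePair X →+ FinCountablePair X →+ ZMod 2 :=
  AddMonoidHom.mk'
    (fun v => AddMonoidHom.mk' (fun w => v.1.sum fun x t => t * w.2.1 x) fun w w' => by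
      simp [mul_add, Finsupp.sum_add])
    fun v v' => by
      ext1 w
      exact Finsupp.sum_add_index' (h := fun x t => t * w.2.1 x) (fun _ => zero_mul _)
        fun _ _ _ => add_mul _ _ _

lemma finCountablePairing_apply (v w : FinCountablePair X) :
    finCountablePairing v w = v.1.sum fun x t => t * w.2.1 x := rfl

/-- The sum of the values of the finitely supported part. -/
noncomputable def totalSum : FinCountablePair X →+ ZMod 2 :=
  AddMonoidHom.mk' (fun v => v.1.sum fun _ t => t) fun _ _ =>
    Finsupp.sum_add_index' (fun _ => rfl) fun _ _ _ => rfl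

lemma totalSum_apply (v : FinCountablePair X) : totalSum v = v.1.sum fun _ t => t := rfl

lemma FinCountablePair.add_self (v : FinCountablePair X) : v + v = 0 := by
  ext x
  · exact CharTwo.add_self_eq_zero (v.1 x)
  · exact CharTwo.add_self_eq_zero (v.2.1 x)

lemma exists_finCountablePairing_eq_one (v : FinCountablePair X) (hv : v ≠ 0) :
    ∃ w, finCountablePairing w v + finCountablePairing v w = 1 := by
  classical
  have key (a : ZMod 2) (ha : a ≠ 0) : a = 1 := by revert a; decide
  by_cases h : v.2 = 0
  · obtain ⟨x, hx⟩ : ∃ x, v.1 x ≠ 0 := by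
      by_contra! h1
      exact hv (Prod.ext (Finsupp.ext h1) h)
    refine ⟨(0, ⟨Pi.single x 1, ?_⟩), ?_⟩
    · exact (Set.countable_singleton x).mono Pi.support_single_subset
    · rw [finCountablePairing_apply, finCountablePairing_apply]
      simp only [Finsupp.sum_zero_index, zero_add, Pi.single_apply, mul_ite, mul_one, mul_zero]
      rw [Finsupp.sum_ite_eq']
      simp [key _ hx]
  · obtain ⟨x, hx⟩ : ∃ x, v.2.1 x ≠ 0 := by
      by_contra! h1
      exact h (Subtype.ext (funext h1))
    exact ⟨(Finsupp.single x 1, 0), by simp [finCountablePairing_apply, key _ hx]⟩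

lemma exists_finCountablePairing_eq_totalSum (C : Set (FinCountablePair X)) (hC : C.Countable) :
    ∃ w, ∀ v ∈ C, finCountablePairing w v + finCountablePairing v w = totalSum v := by
  classical
  refine ⟨(0, ⟨Set.indicator (⋃ v ∈ C, (v.1.support : Set X)) 1, ?_⟩), fun v hv => ?_⟩
  · exact (hC.biUnion fun v _ => v.1.support.countable_toSet).mono Set.support_indicator_subset
  · rw [finCountablePairing_apply, finCountablePairing_apply, totalSum_apply,
      Finsupp.sum_zero_index, zero_add]
    refine Finset.sum_congr rfl fun x hx => ?_
    have : x ∈ ⋃ v ∈ C, (v.1.support : Set X) := Set.mem_biUnion hv hx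
    simp only [Set.indicator_of_mem this, Pi.one_apply, mul_one]

lemma exists_totalSum_eq_one [Uncountable X] (C : Set (FinCountablePair X)) (hC : C.Countable) :
    ∃ v, totalSum v = 1 ∧ ∀ w ∈ C, finCountablePairing v w + finCountablePairing w v = 0 := by
  obtain ⟨x, hx⟩ : ∃ x, x ∉ ⋃ w ∈ C, Function.support w.2.1 := by
    by_contra! h
    have : (⋃ w ∈ C, Function.support w.2.1).Countable := hC.biUnion fun w _ => w.2.2
    rw [Set.eq_univ_of_forall h] at this
    exact Set.not_countable_univ this
  refine ⟨(Finsupp.single x 1, 0), by simp [totalSum_apply], fun w hw => ?_⟩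
  have : w.2.1 x = 0 := by
    by_contra h
    exact hx (Set.mem_biUnion hw h)
  simp [finCountablePairing_apply, this]

end CountableSupport

end TwistedGroupConstruction

/-- **Theorem.** There is an infinite-dimensional simple unital C*-algebra (indeed
a II₁ factor) admitting a faithful tracial state, together with an automorphism
which is locally inner but not inner. -/
theorem exists_simple_tracial_locallyInner_not_inner :
    ∃ (A : Type) (_ : CStarAlgebra A),
      ¬ FiniteDimensional ℂ A ∧
      (∀ I : TwoSidedIdeal A, IsClosed (I : Set A) → I = ⊥ ∨ I = ⊤) ∧
      (∃ τ : A →ₗ[ℂ] ℂ,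
        τ 1 = 1 ∧
        (∀ x : A, ∃ r : ℝ, 0 ≤ r ∧ τ (star x * x) = (r : ℂ)) ∧
        (∀ x y : A, τ (x * y) = τ (y * x)) ∧
        (∀ x : A, τ (star x * x) = 0 → x = 0)) ∧
      ∃ θ : A ≃⋆ₐ[ℂ] A,
        (∀ x : A, ∃ u ∈ unitary A, θ x = u * x * star u) ∧
        ¬ ∃ u ∈ unitary A, ∀ x : A, θ x = u * x * star u := by
  have : Infinite (FinCountablePair ℝ) :=
    Infinite.of_injective (fun x => (Finsupp.single x 1, 0)) fun x y h =>
      Finsupp.single_left_injective one_ne_zero (congrArg Prod.fst h)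
  have hV := FinCountablePair.add_self (X := ℝ)
  let S := twistedGroupSystem finCountablePairing hV
  exact ⟨twistedGroupAlgebra finCountablePairing hV, inferInstance, S.not_finiteDimensional hV,
    fun I _ => S.eq_bot_or_eq_top exists_finCountablePairing_eq_one I,
    ⟨S.τ.toLinearMap, S.τ_one, S.τ_nonneg, S.τ_mul_comm hV, S.τ_faithful⟩,
    dualAutomorphism finCountablePairing hV totalSum,
    S.exists_unitary_conj totalSum exists_finCountablePairing_eq_totalSum _
      (dualAutomorphism_U _ hV totalSum),
    S.not_exists_unitary_forall_conj totalSum exists_totalSum_eq_one _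
      (dualAutomorphism_U _ hV totalSum)⟩
end
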